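/- arXiv:math/0611538 — 3 statements merged into one kernel-verified Lean document; each statement's English description precedes it below -/
import Mathlib

section
/- Let π be a permutation of {1,…,n} with π_1 = r_0, lower record values 1 = r_{−ℓ} < ⋯ < r_{−1} < r_0 and upper record values r_0 < r_1 < ⋯ < r_u = n. Let m > n and a, b ≥ 0 be integers, and let 1 = s_{−ℓ−b} < ⋯ < s_0 < ⋯ < s_{u+a} = m be a strictly increasing sequence of integers indexed by −ℓ−b ≤ k ≤ u+a. Put λ_0 = 1, λ_k = r_k − r_{k−1} for 1 ≤ k ≤ u, λ_k = r_{k+1} − r_k for −ℓ ≤ k ≤ −1, and likewise μ_0 = 1, μ_k = s_k − s_{k−1} for 1 ≤ k ≤ u+a, μ_k = s_{k+1} − s_k for −ℓ−b ≤ k ≤ −1. Let N be the number of permutations π' of {1,…,m} that are coherent with π and satisfy: π'_1 = s_0, the set of lower record values of π' equals {s_{−ℓ−b},…,s_0}, and the set of upper record values of π' equals {s_0,…,s_{u+a}}. Then N · ∏_{k=1}^{a} (m − s_{u+k−1}) · ∏_{k=1}^{b} (s_{−ℓ−k+1} − 1) = (m−n)! · ∏_{k=−ℓ}^{u} C(μ_k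 − 1, λ_k − 1), where C(·,·) is the binomial coefficient (equal to 0 when the lower index exceeds the upper index). -/
open Finset

/-- `π j` is a lower record: it is the minimum among the first `j+1` entries. -/
def isLowerRecord {n : ℕ} (π : Equiv.Perm (Fin n)) (j : Fin n) : Prop :=
  ∀ k, k ≤ j → π j ≤ π k

/-- `π j` is an upper record: it is the maximum among the first `j+1` entries. -/
def isUpperRecord {n : ℕ} (π : Equiv.Perm (Fin n)) (j : Fin n) : Prop :=
  ∀ k, k ≤ j → π k ≤ π j

instance {n : ℕ} (π : Equiv.Perm (Fin n)) (j : Fin n) : Decidable (isLowerRecord π j) :=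
  inferInstanceAs (Decidable (∀ k, k ≤ j → π j ≤ π k))

instance {n : ℕ} (π : Equiv.Perm (Fin n)) (j : Fin n) : Decidable (isUpperRecord π j) :=
  inferInstanceAs (Decidable (∀ k, k ≤ j → π k ≤ π j))

/-- number of proper (position ≥ 2, i.e. index ≥ 1) lower records -/
def properLowerCount {n : ℕ} (π : Equiv.Perm (Fin n)) : ℕ :=
  (univ.filter fun j : Fin n => 0 < j.val ∧ isLowerRecord π j).card

/-- number of proper (position ≥ 2, i.e. index ≥ 1) upper records -/
def properUpperCount {n : ℕ} (π : Equiv.Perm (Fin n)) : ℕ :=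
  (univ.filter fun j : Fin n => 0 < j.val ∧ isUpperRecord π j).card

/-- `A n ℓ u` = number of permutations of `{1,…,n}` with exactly `ℓ` proper lower
records and exactly `u` proper upper records. -/
def A (n ℓ u : ℕ) : ℕ :=
  (univ.filter fun π : Equiv.Perm (Fin n) =>
    properLowerCount π = ℓ ∧ properUpperCount π = u).card

/-- the set of lower record values of `π`, as 1-based values in `{1,…,n}` -/
def lowerRecValues {n : ℕ} (π : Equiv.Perm (Fin n)) : Finset ℕ :=
  (univ.filter fun j : Fin n => isLowerRecord π j).image fun j => (π j).val + 1

/-- the set of upper record values of `π`, as 1-based values in `{1,…,n}` -/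
def upperRecValues {n : ℕ} (π : Equiv.Perm (Fin n)) : Finset ℕ :=
  (univ.filter fun j : Fin n => isUpperRecord π j).image fun j => (π j).val + 1

/-- `π'` (a permutation of `{1,…,m}`) is coherent with `π` (of `{1,…,n}`, `n ≤ m`):
the ranking of the first `n` entries of `π'` equals `π`, i.e.
`π_j = #{k ≤ n : π'_k ≤ π'_j}` for every `j ≤ n`. -/
def CoherentWith {n m : ℕ} (h : n ≤ m) (π' : Equiv.Perm (Fin m)) (π : Equiv.Perm (Fin n)) :
    Prop :=
  ∀ j : Fin n, (π j).val + 1 =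
    (univ.filter fun k : Fin m => k.val < n ∧ π' k ≤ π' (Fin.castLE h j)).card

instance {n m : ℕ} (h : n ≤ m) (π' : Equiv.Perm (Fin m)) (π : Equiv.Perm (Fin n)) :
    Decidable (CoherentWith h π' π) :=
  inferInstanceAs (Decidable (∀ j : Fin n, (π j).val + 1 =
    (univ.filter fun k : Fin m => k.val < n ∧ π' k ≤ π' (Fin.castLE h j)).card))

/-- the parts `λ_k` of the centered composition encoding a record-value sequence `r`:
`λ_0 = 1`, `λ_k = r_k − r_{k−1}` for `k > 0`, `λ_k = r_{k+1} − r_k` for `k < 0`. -/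
def partsOf (r : ℤ → ℕ) (k : ℤ) : ℕ :=
  if 0 < k then r k - r (k - 1) else if k < 0 then r (k + 1) - r k else 1

/-- The permutation of `Fin (n + 1)` with last entry `v` whose first `n` entries are ranked
as `π`. -/
def insertLast {n : ℕ} (π : Equiv.Perm (Fin n)) (v : Fin (n + 1)) : Equiv.Perm (Fin (n + 1)) :=
  ((finSuccEquiv' (Fin.last n)).trans π.optionCongr).trans (finSuccEquiv' v).symm

@[simp]
theorem insertLast_last {n : ℕ} (π : Equiv.Perm (Fin n)) (v : Fin (n + 1)) :
    insertLast π v (Fin.last n) = v := by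
  simp [insertLast]

@[simp]
theorem insertLast_castSucc {n : ℕ} (π : Equiv.Perm (Fin n)) (v : Fin (n + 1)) (i : Fin n) :
    insertLast π v i.castSucc = v.succAbove (π i) := by
  have h : finSuccEquiv' (Fin.last n) i.castSucc = some i :=
    finSuccEquiv'_below (Fin.castSucc_lt_last i)
  simp [insertLast, h]

/-- The effect on old (1-based) values of inserting a new entry of 1-based value `v + 1`. -/
def shiftAbove (v x : ℕ) : ℕ := if x ≤ v then x else x + 1

theorem shiftAbove_strictMono (v : ℕ) : StrictMono (shiftAbove v) := by
  intro x y h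
  unfold shiftAbove
  split_ifs <;> omega

theorem succAbove_val_add_one {n : ℕ} (v : Fin (n + 1)) (i : Fin n) :
    (v.succAbove i).val + 1 = shiftAbove v (i.val + 1) := by
  unfold shiftAbove Fin.succAbove
  simp only [Fin.lt_def, Fin.val_castSucc]
  split_ifs <;> simp <;> omega

theorem isUpperRecord_insertLast_castSucc {n : ℕ} (π : Equiv.Perm (Fin n)) (v : Fin (n + 1))
    (i : Fin n) : isUpperRecord (insertLast π v) i.castSucc ↔ isUpperRecord π i := by
  constructor
  · intro h k hk
    simpa using h k.castSucc (by simpa using hk)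
  · intro h k hk
    induction k using Fin.lastCases with
    | last => exact absurd hk (by simp)
    | cast k => simpa using h k (by simpa using hk)

theorem isLowerRecord_insertLast_castSucc {n : ℕ} (π : Equiv.Perm (Fin n)) (v : Fin (n + 1))
    (i : Fin n) : isLowerRecord (insertLast π v) i.castSucc ↔ isLowerRecord π i := by
  constructor
  · intro h k hk
    simpa using h k.castSucc (by simpa using hk)
  · intro h k hk
    induction k using Fin.lastCases with
    | last => exact absurd hk (by simp)
    | cast k => simpa using h k (by simpa using hk)

theorem isUpperRecord_insertLast_last {n : ℕ} (π : Equiv.Perm (Fin n)) (v : Fin (n + 1)) :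
    isUpperRecord (insertLast π v) (Fin.last n) ↔ v.val = n := by
  constructor
  · intro h
    have h1 := h ((insertLast π v).symm (Fin.last n)) (Fin.le_last _)
    simp only [Equiv.apply_symm_apply, insertLast_last, Fin.le_def, Fin.val_last] at h1
    omega
  · intro h k _
    rw [insertLast_last, Fin.le_def]
    omega

theorem isLowerRecord_insertLast_last {n : ℕ} (π : Equiv.Perm (Fin n)) (v : Fin (n + 1)) :
    isLowerRecord (insertLast π v) (Fin.last n) ↔ v.val = 0 := by
  constructor
  · intro h
    have h1 := h ((insertLast π v).symm 0) (Fin.le_last _)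
    simp only [Equiv.apply_symm_apply, insertLast_last, Fin.le_def, Fin.val_zero] at h1
    omega
  · intro h k _
    rw [insertLast_last, Fin.le_def]
    omega

theorem mem_upperRecValues {n : ℕ} (π : Equiv.Perm (Fin n)) (x : ℕ) :
    x ∈ upperRecValues π ↔ ∃ j, isUpperRecord π j ∧ (π j).val + 1 = x := by
  simp [upperRecValues]

theorem mem_lowerRecValues {n : ℕ} (π : Equiv.Perm (Fin n)) (x : ℕ) :
    x ∈ lowerRecValues π ↔ ∃ j, isLowerRecord π j ∧ (π j).val + 1 = x := by
  simp [lowerRecValues]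

theorem upperRecValues_insertLast {n : ℕ} (π : Equiv.Perm (Fin n)) (v : Fin (n + 1)) :
    upperRecValues (insertLast π v) =
      (upperRecValues π).image (shiftAbove v) ∪ if v.val = n then {n + 1} else ∅ := by
  ext x
  rw [mem_upperRecValues, mem_union, mem_image, Fin.exists_fin_succ']
  simp only [isUpperRecord_insertLast_castSucc, isUpperRecord_insertLast_last, insertLast_last,
    insertLast_castSucc, mem_upperRecValues, succAbove_val_add_one]
  refine or_congr ?_ ?_
  · constructor
    · rintro ⟨i, hi, rfl⟩
      exact ⟨_, ⟨i, hi, rfl⟩, rfl⟩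
    · rintro ⟨_, ⟨i, hi, rfl⟩, rfl⟩
      exact ⟨i, hi, rfl⟩
  · split_ifs <;> simp <;> omega

theorem lowerRecValues_insertLast {n : ℕ} (π : Equiv.Perm (Fin n)) (v : Fin (n + 1)) :
    lowerRecValues (insertLast π v) =
      (lowerRecValues π).image (shiftAbove v) ∪ if v.val = 0 then {1} else ∅ := by
  ext x
  rw [mem_lowerRecValues, mem_union, mem_image, Fin.exists_fin_succ']
  simp only [isLowerRecord_insertLast_castSucc, isLowerRecord_insertLast_last, insertLast_last,
    insertLast_castSucc, mem_lowerRecValues, succAbove_val_add_one]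
  refine or_congr ?_ ?_
  · constructor
    · rintro ⟨i, hi, rfl⟩
      exact ⟨_, ⟨i, hi, rfl⟩, rfl⟩
    · rintro ⟨_, ⟨i, hi, rfl⟩, rfl⟩
      exact ⟨i, hi, rfl⟩
  · split_ifs with hv <;> simp only [hv, mem_singleton, notMem_empty] <;> grind

/-- The number of entries smaller than `π' ⟨n, _⟩` among the first `n` entries of `π'`. -/
def nextRank {n m : ℕ} (h : n < m) (π' : Equiv.Perm (Fin m)) : ℕ :=
  (univ.filter fun k : Fin m => k.val < n ∧ π' k < π' ⟨n, h⟩).card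

theorem nextRank_lt {n m : ℕ} (h : n < m) (π' : Equiv.Perm (Fin m)) :
    nextRank h π' < n + 1 := by
  have h1 : nextRank h π' ≤ (univ.filter fun k : Fin m => k.val < n).card :=
    card_le_card fun k hk => by simp_all
  rw [Fin.card_filter_val_lt] at h1
  omega

theorem coherentWith_insertLast_iff {n m : ℕ} (h : n < m) (π' : Equiv.Perm (Fin m))
    (π : Equiv.Perm (Fin n)) (v : Fin (n + 1)) :
    CoherentWith (Nat.succ_le_of_lt h) π' (insertLast π v) ↔
      CoherentWith h.le π' π ∧ nextRank h π' = v := by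
  have hlast : (univ.filter fun k : Fin m => k.val < n + 1 ∧ π' k ≤ π' ⟨n, h⟩).card =
      nextRank h π' + 1 := by
    have : (univ.filter fun k : Fin m => k.val < n + 1 ∧ π' k ≤ π' ⟨n, h⟩) =
        insert ⟨n, h⟩ (univ.filter fun k : Fin m => k.val < n ∧ π' k < π' ⟨n, h⟩) := by
      ext k
      simp only [mem_filter_univ, mem_insert, Fin.ext_iff]
      constructor
      · rintro ⟨h1, h2⟩
        by_cases hk : k.val = n
        · exact Or.inl hk
        · refine Or.inr ⟨by omega, lt_of_le_of_ne h2 fun h3 => hk ?_⟩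
          simpa [Fin.ext_iff] using π'.injective h3
      · rintro (h1 | ⟨h1, h2⟩)
        · have : k = ⟨n, h⟩ := Fin.ext h1
          subst this
          simp
        · exact ⟨by omega, h2.le⟩
    rw [this, card_insert_of_notMem (by simp), nextRank]
  have hcast : ∀ j : Fin n,
      (π' ⟨n, h⟩ < π' (Fin.castLE h.le j) ∧
        (univ.filter fun k : Fin m => k.val < n + 1 ∧ π' k ≤ π' (Fin.castLE h.le j)).card =
        (univ.filter fun k : Fin m => k.val < n ∧ π' k ≤ π' (Fin.castLE h.le j)).card + 1 ∧
        nextRank h π' <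
          (univ.filter fun k : Fin m => k.val < n ∧ π' k ≤ π' (Fin.castLE h.le j)).card) ∨
      ((univ.filter fun k : Fin m => k.val < n + 1 ∧ π' k ≤ π' (Fin.castLE h.le j)).card =
        (univ.filter fun k : Fin m => k.val < n ∧ π' k ≤ π' (Fin.castLE h.le j)).card ∧
        (univ.filter fun k : Fin m => k.val < n ∧ π' k ≤ π' (Fin.castLE h.le j)).card ≤
          nextRank h π') := by
    intro j
    have hne : π' (Fin.castLE h.le j) ≠ π' ⟨n, h⟩ := fun h3 => by
      have := π'.injective h3
      simp only [Fin.ext_iff, Fin.val_castLE] at this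
      omega
    rcases lt_or_gt_of_ne hne with hlt | hgt
    · right
      constructor
      · congr 1
        ext k
        simp only [mem_filter_univ]
        refine and_congr_left fun hk => ⟨fun h1 => ?_, fun h1 => by omega⟩
        by_contra h2
        have : k = ⟨n, h⟩ := Fin.ext (by simp; omega)
        subst this
        exact absurd hk (not_le.2 hlt)
      · refine card_le_card fun k => ?_
        simp only [mem_filter_univ]
        exact fun hk => ⟨hk.1, hk.2.trans_lt hlt⟩
    · refine Or.inl ⟨hgt, ?_, ?_⟩
      · rw [← card_insert_of_notMem (a := (⟨n, h⟩ : Fin m)) (by simp)]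
        congr 1
        ext k
        simp only [mem_filter_univ, mem_insert, Fin.ext_iff]
        constructor
        · rintro ⟨h1, h2⟩
          by_cases hk : k.val = n
          · exact Or.inl hk
          · exact Or.inr ⟨by omega, h2⟩
        · rintro (h1 | ⟨h1, h2⟩)
          · have : k = ⟨n, h⟩ := Fin.ext h1
            subst this
            exact ⟨by simp, hgt.le⟩
          · exact ⟨by omega, h2⟩
      · refine card_lt_card ?_
        rw [ssubset_iff_of_subset]
        · refine ⟨Fin.castLE h.le j, by simp, ?_⟩
          simp [hgt.le]
        · intro k
          simp only [mem_filter_univ]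
          exact fun hk => ⟨hk.1, (hk.2.trans hgt).le⟩
  unfold CoherentWith
  rw [Fin.forall_fin_succ']
  simp only [insertLast_last, insertLast_castSucc, succAbove_val_add_one]
  have e1 : Fin.castLE (Nat.succ_le_of_lt h) (Fin.last n) = ⟨n, h⟩ := rfl
  have e2 : ∀ j : Fin n, Fin.castLE (Nat.succ_le_of_lt h) j.castSucc = Fin.castLE h.le j :=
    fun _ => rfl
  simp only [e1, e2, hlast]
  have key : nextRank h π' = v → ∀ j : Fin n,
      (shiftAbove v ((π j).val + 1) =
        (univ.filter fun k : Fin m => k.val < n + 1 ∧ π' k ≤ π' (Fin.castLE h.le j)).card ↔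
      (π j).val + 1 =
        (univ.filter fun k : Fin m => k.val < n ∧ π' k ≤ π' (Fin.castLE h.le j)).card) := by
    intro hv j
    unfold shiftAbove
    rcases hcast j with ⟨-, h1, h2⟩ | ⟨h1, h2⟩ <;> rw [h1] <;> split_ifs <;> omega
  constructor
  · rintro ⟨h1, h2⟩
    have hv : nextRank h π' = v := by omega
    exact ⟨fun j => (key hv j).1 (h1 j), hv⟩
  · rintro ⟨h1, hv⟩
    exact ⟨fun j => (key hv j).2 (h1 j), by omega⟩

/-- The number of permutations coherent with `π` that satisfy `Q`. -/
def coherentCount {n m : ℕ} (h : n ≤ m) (π : Equiv.Perm (Fin n))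
    (Q : Equiv.Perm (Fin m) → Prop) [DecidablePred Q] : ℕ :=
  (univ.filter fun π' => CoherentWith h π' π ∧ Q π').card

theorem coherentCount_eq_sum {n m : ℕ} (h : n < m) (π : Equiv.Perm (Fin n))
    (Q : Equiv.Perm (Fin m) → Prop) [DecidablePred Q] :
    coherentCount h.le π Q =
      ∑ v : Fin (n + 1), coherentCount (Nat.succ_le_of_lt h) (insertLast π v) Q := by
  unfold coherentCount
  rw [card_eq_sum_card_fiberwise (f := fun π' => (⟨nextRank h π', nextRank_lt h π'⟩ : Fin (n + 1)))
    (t := univ) (fun _ _ => mem_coe.2 (mem_univ _))]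
  refine sum_congr rfl fun v _ => ?_
  congr 1
  ext π'
  have := coherentWith_insertLast_iff h π' π v
  simp only [mem_filter, mem_univ, true_and, Fin.ext_iff]
  tauto

theorem CoherentWith.le_iff {n m : ℕ} {h : n ≤ m} {π' : Equiv.Perm (Fin m)}
    {π : Equiv.Perm (Fin n)} (hc : CoherentWith h π' π) (i j : Fin n) :
    π i ≤ π j ↔ π' (Fin.castLE h i) ≤ π' (Fin.castLE h j) := by
  have mono : ∀ i j : Fin n, π' (Fin.castLE h i) ≤ π' (Fin.castLE h j) → π i ≤ π j := by
    intro i j hij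
    have := card_le_card (s := univ.filter fun k : Fin m => k.val < n ∧ π' k ≤ π' (Fin.castLE h i))
      (t := univ.filter fun k : Fin m => k.val < n ∧ π' k ≤ π' (Fin.castLE h j)) (fun k => by
        simp only [mem_filter_univ]
        exact fun hk => ⟨hk.1, hk.2.trans hij⟩)
    rw [← hc i, ← hc j] at this
    exact Fin.le_def.2 (by omega)
  refine ⟨fun hij => ?_, mono i j⟩
  by_contra hlt
  have : i = j := π.injective (le_antisymm hij (mono j i (not_le.1 hlt).le))
  exact hlt (this ▸ le_rfl)

theorem card_upperRecValues {n : ℕ} (π : Equiv.Perm (Fin n)) :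
    (upperRecValues π).card = (univ.filter fun j => isUpperRecord π j).card :=
  card_image_of_injective _ fun i j hij => π.injective (Fin.ext (by simpa using hij))

theorem card_lowerRecValues {n : ℕ} (π : Equiv.Perm (Fin n)) :
    (lowerRecValues π).card = (univ.filter fun j => isLowerRecord π j).card :=
  card_image_of_injective _ fun i j hij => π.injective (Fin.ext (by simpa using hij))

theorem CoherentWith.card_upperRecValues_le {n m : ℕ} {h : n ≤ m} {π' : Equiv.Perm (Fin m)}
    {π : Equiv.Perm (Fin n)} (hc : CoherentWith h π' π) :
    (upperRecValues π).card ≤ (upperRecValues π').card := by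
  rw [card_upperRecValues, card_upperRecValues]
  refine card_le_card_of_injOn (Fin.castLE h) ?_ (Fin.castLE_injective h).injOn
  intro j hj
  simp only [coe_filter, mem_univ, true_and, Set.mem_ofPred_eq] at hj ⊢
  intro k hk
  exact (hc.le_iff ⟨k, lt_of_le_of_lt hk j.isLt⟩ j).1 (hj _ hk)

theorem CoherentWith.card_lowerRecValues_le {n m : ℕ} {h : n ≤ m} {π' : Equiv.Perm (Fin m)}
    {π : Equiv.Perm (Fin n)} (hc : CoherentWith h π' π) :
    (lowerRecValues π).card ≤ (lowerRecValues π').card := by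
  rw [card_lowerRecValues, card_lowerRecValues]
  refine card_le_card_of_injOn (Fin.castLE h) ?_ (Fin.castLE_injective h).injOn
  intro j hj
  simp only [coe_filter, mem_univ, true_and, Set.mem_ofPred_eq] at hj ⊢
  intro k hk
  exact (hc.le_iff j ⟨k, lt_of_le_of_lt hk j.isLt⟩).1 (hj _ hk)

theorem coherentWith_self_iff {n : ℕ} (π' π : Equiv.Perm (Fin n)) :
    CoherentWith le_rfl π' π ↔ π' = π := by
  have hcard : ∀ j : Fin n, (univ.filter fun k : Fin n => k.val < n ∧ π' k ≤ π' j).card =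
      (π' j).val + 1 := by
    intro j
    rw [← Fin.card_Iic, ← card_map π'.toEmbedding]
    congr 1
    ext k
    simp
  have e : ∀ j : Fin n, Fin.castLE le_rfl j = j := fun _ => rfl
  unfold CoherentWith
  simp only [e, hcard, Equiv.ext_iff, Fin.ext_iff]
  exact forall_congr' fun j => by omega

/-- `r` on `[lo, hi]` lists the record values of `π`, centered at the first entry. -/
structure IsRecordSeq {n : ℕ} (hn : 0 < n) (π : Equiv.Perm (Fin n)) (r : ℤ → ℕ) (lo hi : ℤ) :
    Prop where
  center : (π ⟨0, hn⟩).val + 1 = r 0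
  lower : lowerRecValues π = (Finset.Icc lo 0).image r
  upper : upperRecValues π = (Finset.Icc 0 hi).image r

theorem IsRecordSeq.insertLast_mid {n : ℕ} {hn : 0 < n} {π : Equiv.Perm (Fin n)} {r : ℤ → ℕ}
    {lo hi : ℤ} (h : IsRecordSeq hn π r lo hi) {v : Fin (n + 1)} (h0 : v.val ≠ 0)
    (hv : v.val ≠ n) :
    IsRecordSeq n.succ_pos (insertLast π v) (fun j => shiftAbove v (r j)) lo hi where
  center := by
    rw [← h.center, ← succAbove_val_add_one, ← insertLast_castSucc]
    rfl
  lower := by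
    rw [lowerRecValues_insertLast, if_neg h0, h.lower, image_image, union_empty]
    rfl
  upper := by
    rw [upperRecValues_insertLast, if_neg hv, h.upper, image_image, union_empty]
    rfl

theorem IsRecordSeq.insertLast_max {n : ℕ} {hn : 0 < n} {π : Equiv.Perm (Fin n)} {r : ℤ → ℕ}
    {lo hi : ℤ} (h : IsRecordSeq hn π r lo hi) (hhi : 0 ≤ hi)
    (hle : ∀ j ∈ Set.Icc lo hi, r j ≤ n) :
    IsRecordSeq n.succ_pos (insertLast π (Fin.last n)) (fun j => if j ≤ hi then r j else n + 1)
      lo (hi + 1) where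
  center := by
    have h1 : insertLast π (Fin.last n) ⟨0, n.succ_pos⟩ = (Fin.last n).succAbove (π ⟨0, hn⟩) :=
      insertLast_castSucc π _ ⟨0, hn⟩
    rw [h1, if_pos hhi, ← h.center, Fin.succAbove_last, Fin.val_castSucc]
  lower := by
    rw [lowerRecValues_insertLast, if_neg (by simpa using hn.ne'), h.lower, image_image,
      union_empty]
    refine image_congr fun j hj => ?_
    rw [coe_Icc] at hj
    have h1 := hle j ⟨hj.1, hj.2.trans hhi⟩
    simp [shiftAbove, h1, hj.2.trans hhi]
  upper := by
    have hlo : ∀ j ∈ Finset.Icc 0 hi, r j ≤ n := by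
      intro j hj
      have : r j ∈ upperRecValues π := h.upper ▸ mem_image_of_mem r hj
      obtain ⟨i, -, hi⟩ := (mem_upperRecValues _ _).1 this
      omega
    have h1 : Finset.Icc 0 (hi + 1) = Finset.Icc 0 hi ∪ {hi + 1} := by
      ext j
      simp only [mem_Icc, mem_union, mem_singleton]
      omega
    rw [upperRecValues_insertLast, if_pos (by simp), h.upper, image_image, h1, image_union,
      image_singleton, if_neg (by omega)]
    congr 1
    refine image_congr fun j hj => ?_
    have h2 := hlo j hj
    rw [coe_Icc] at hj
    simp [shiftAbove, h2, hj.2]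

theorem IsRecordSeq.insertLast_zero {n : ℕ} {hn : 0 < n} {π : Equiv.Perm (Fin n)} {r : ℤ → ℕ}
    {lo hi : ℤ} (h : IsRecordSeq hn π r lo hi) (hlo : lo ≤ 0)
    (hpos : ∀ j ∈ Set.Icc lo hi, r j ≠ 0) :
    IsRecordSeq n.succ_pos (insertLast π 0) (fun j => if lo ≤ j then r j + 1 else 1)
      (lo - 1) hi where
  center := by
    have h1 : insertLast π 0 ⟨0, n.succ_pos⟩ = (0 : Fin (n + 1)).succAbove (π ⟨0, hn⟩) :=
      insertLast_castSucc π _ ⟨0, hn⟩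
    rw [h1, if_pos hlo, ← h.center, Fin.succAbove_zero, Fin.val_succ]
  lower := by
    have hlo : ∀ j ∈ Finset.Icc lo 0, r j ≠ 0 := by
      intro j hj
      have : r j ∈ lowerRecValues π := h.lower ▸ mem_image_of_mem r hj
      obtain ⟨i, -, hi⟩ := (mem_lowerRecValues _ _).1 this
      omega
    have h1 : Finset.Icc (lo - 1) 0 = Finset.Icc lo 0 ∪ {lo - 1} := by
      ext j
      simp only [mem_Icc, mem_union, mem_singleton]
      omega
    rw [lowerRecValues_insertLast, if_pos (by simp), h.lower, image_image, h1, image_union,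
      image_singleton, if_neg (by omega)]
    congr 1
    refine image_congr fun j hj => ?_
    have h2 := hlo j hj
    rw [coe_Icc] at hj
    simp [shiftAbove, h2, hj.1]
  upper := by
    rw [upperRecValues_insertLast, if_neg (by simpa using hn.ne), h.upper, image_image,
      union_empty]
    refine image_congr fun j hj => ?_
    rw [coe_Icc] at hj
    have h1 := hpos j ⟨hlo.trans hj.1, hj.2⟩
    simp [shiftAbove, h1, hlo.trans hj.1]

theorem IsRecordSeq.card_upper {n : ℕ} {hn : 0 < n} {π : Equiv.Perm (Fin n)} {r : ℤ → ℕ}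
    {lo hi : ℤ} (h : IsRecordSeq hn π r lo hi) (hlo : lo ≤ 0)
    (hr : StrictMonoOn r (Set.Icc lo hi)) : (upperRecValues π).card = (hi + 1).toNat := by
  rw [h.upper, card_image_of_injOn, Int.card_Icc, sub_zero]
  refine hr.injOn.mono fun j hj => ?_
  rw [coe_Icc] at hj
  exact ⟨hlo.trans hj.1, hj.2⟩

theorem IsRecordSeq.card_lower {n : ℕ} {hn : 0 < n} {π : Equiv.Perm (Fin n)} {r : ℤ → ℕ}
    {lo hi : ℤ} (h : IsRecordSeq hn π r lo hi) (hhi : 0 ≤ hi)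
    (hr : StrictMonoOn r (Set.Icc lo hi)) : (lowerRecValues π).card = (1 - lo).toNat := by
  rw [h.lower, card_image_of_injOn, Int.card_Icc, zero_add]
  refine hr.injOn.mono fun j hj => ?_
  rw [coe_Icc] at hj
  exact ⟨hj.1, hj.2.trans hhi⟩

/-- Two increasing enumerations of the same set by initial segments of `ℕ` agree. -/
theorem eqOn_of_image_eq {α : Type*} [LinearOrder α] {f g : ℕ → α} {u : ℕ}
    (hf : StrictMonoOn f (Set.Iic u)) (hg : StrictMonoOn g (Set.Iic u))
    (h : f '' Set.Iic u = g '' Set.Iic u) : Set.EqOn f g (Set.Iic u) := by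
  have key : ∀ {f g : ℕ → α}, StrictMonoOn f (Set.Iic u) → StrictMonoOn g (Set.Iic u) →
      f '' Set.Iic u = g '' Set.Iic u → ∀ k ≤ u, (∀ i < k, f i = g i) → g k ≤ f k := by
    intro f g hf hg h k hk ih
    obtain ⟨i, hi, hik⟩ := h ▸ Set.mem_image_of_mem f (Set.mem_Iic.2 hk)
    rw [← hik]
    refine hg.monotoneOn hk hi ?_
    by_contra! hlt
    exact hlt.ne (hf.injOn hi hk ((ih i hlt).trans hik))
  intro k hk
  induction k using Nat.strong_induction_on with
  | _ k ih =>
    have ih' : ∀ i < k, f i = g i := fun i hi => ih i hi (hi.le.trans hk)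
    exact le_antisymm (key hg hf h.symm k hk fun i hi => (ih' i hi).symm) (key hf hg h k hk ih')

theorem IsRecordSeq.unique {n : ℕ} {hn : 0 < n} {π : Equiv.Perm (Fin n)} {r s : ℤ → ℕ}
    {lo hi lo' hi' : ℤ} (h : IsRecordSeq hn π r lo hi) (h' : IsRecordSeq hn π s lo' hi')
    (hlo : lo ≤ 0) (hhi : 0 ≤ hi) (hlo' : lo' ≤ 0) (hhi' : 0 ≤ hi')
    (hr : StrictMonoOn r (Set.Icc lo hi)) (hs : StrictMonoOn s (Set.Icc lo' hi')) :
    lo = lo' ∧ hi = hi' ∧ Set.EqOn r s (Set.Icc lo hi) := by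
  have e1 := h.card_upper hlo hr
  have e2 := h.card_lower hhi hr
  rw [h'.card_upper hlo' hs] at e1
  rw [h'.card_lower hhi' hs] at e2
  obtain rfl : lo = lo' := by omega
  obtain rfl : hi = hi' := by omega
  refine ⟨rfl, rfl, ?_⟩
  obtain ⟨p, rfl⟩ := Int.eq_ofNat_of_zero_le hhi
  obtain ⟨q, hq⟩ := Int.eq_ofNat_of_zero_le (neg_nonneg.2 hlo)
  obtain rfl : lo = -q := by omega
  have hup : Set.EqOn (fun k : ℕ => r k) (fun k : ℕ => s k) (Set.Iic p) := by
    have im : ∀ f : ℤ → ℕ, (fun k : ℕ => f k) '' Set.Iic p = f '' Set.Icc 0 p := by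
      intro f
      ext x
      constructor
      · rintro ⟨k, hk, rfl⟩
        exact ⟨k, by simpa using hk, rfl⟩
      · rintro ⟨k, hk, rfl⟩
        lift k to ℕ using hk.1
        exact ⟨k, by simpa using hk, rfl⟩
    have mono : ∀ f : ℤ → ℕ, StrictMonoOn f (Set.Icc (-q) p) →
        StrictMonoOn (fun k : ℕ => f k) (Set.Iic p) := by
      intro f hf i hi j hj hij
      simp only [Set.mem_Iic] at hi hj
      exact hf ⟨by omega, by omega⟩ ⟨by omega, by omega⟩ (by omega)
    refine eqOn_of_image_eq (mono r hr) (mono s hs) ?_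
    rw [im, im]
    simpa only [coe_image, coe_Icc] using
      congrArg (fun t : Finset ℕ => (t : Set ℕ)) (h.upper.symm.trans h'.upper)
  have hdown : Set.EqOn (fun k : ℕ => OrderDual.toDual (r (-k)))
      (fun k : ℕ => OrderDual.toDual (s (-k))) (Set.Iic q) := by
    have im : ∀ f : ℤ → ℕ, (fun k : ℕ => OrderDual.toDual (f (-k))) '' Set.Iic q =
        f '' Set.Icc (-q) 0 := by
      intro f
      ext x
      constructor
      · rintro ⟨k, hk, rfl⟩
        exact ⟨-k, by simpa using hk, rfl⟩
      · rintro ⟨k, hk, rfl⟩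
        obtain ⟨i, hi⟩ := Int.eq_ofNat_of_zero_le (neg_nonneg.2 hk.2)
        obtain rfl : k = -i := by omega
        exact ⟨i, by simpa using hk, rfl⟩
    have mono : ∀ f : ℤ → ℕ, StrictMonoOn f (Set.Icc (-q) p) →
        StrictMonoOn (fun k : ℕ => OrderDual.toDual (f (-k))) (Set.Iic q) := by
      intro f hf i hi j hj hij
      simp only [Set.mem_Iic] at hi hj
      exact hf ⟨by omega, by omega⟩ ⟨by omega, by omega⟩ (by omega)
    refine eqOn_of_image_eq (mono r hr) (mono s hs) ?_
    rw [im, im]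
    change r '' _ = s '' _
    simpa only [coe_image, coe_Icc] using
      congrArg (fun t : Finset ℕ => (t : Set ℕ)) (h.lower.symm.trans h'.lower)
  intro k hk
  rcases le_total 0 k with h0 | h0
  · lift k to ℕ using h0
    exact hup (by simpa using hk.2)
  · obtain ⟨i, hi⟩ := Int.eq_ofNat_of_zero_le (neg_nonneg.2 h0)
    obtain rfl : k = -i := by omega
    exact hdown (by simpa using hk.1)

/-- `r` increases on `[lo, hi]`, an interval around `0`, from `1` to `n`. -/
structure IsValueSeq (n : ℕ) (r : ℤ → ℕ) (lo hi : ℤ) : Prop where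
  lo_le : lo ≤ 0
  le_hi : 0 ≤ hi
  mono : StrictMonoOn r (Set.Icc lo hi)
  apply_lo : r lo = 1
  apply_hi : r hi = n

namespace IsValueSeq

variable {n : ℕ} {r : ℤ → ℕ} {lo hi : ℤ}

theorem lo_le_hi (h : IsValueSeq n r lo hi) : lo ≤ hi := h.lo_le.trans h.le_hi

theorem one_le (h : IsValueSeq n r lo hi) {j : ℤ} (h1 : lo ≤ j) (h2 : j ≤ hi) : 1 ≤ r j :=
  h.apply_lo ▸ h.mono.monotoneOn ⟨le_rfl, h.lo_le_hi⟩ ⟨h1, h2⟩ h1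

theorem le_last (h : IsValueSeq n r lo hi) {j : ℤ} (h1 : lo ≤ j) (h2 : j ≤ hi) : r j ≤ n :=
  h.apply_hi ▸ h.mono.monotoneOn ⟨h1, h2⟩ ⟨h.lo_le_hi, le_rfl⟩ h2

theorem lt_succ (h : IsValueSeq n r lo hi) {j : ℤ} (h1 : lo ≤ j) (h2 : j < hi) :
    r j < r (j + 1) :=
  h.mono ⟨h1, h2.le⟩ ⟨by omega, by omega⟩ (by omega)

theorem shift (h : IsValueSeq n r lo hi) {v : ℕ} (h0 : v ≠ 0) (hv : v < n) :
    IsValueSeq (n + 1) (fun j => shiftAbove v (r j)) lo hi where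
  lo_le := h.lo_le
  le_hi := h.le_hi
  mono := (shiftAbove_strictMono v).comp_strictMonoOn h.mono
  apply_lo := by
    rw [h.apply_lo, shiftAbove, if_pos (by omega)]
  apply_hi := by
    rw [h.apply_hi, shiftAbove, if_neg (by omega)]

theorem extend_max (h : IsValueSeq n r lo hi) :
    IsValueSeq (n + 1) (fun j => if j ≤ hi then r j else n + 1) lo (hi + 1) where
  lo_le := h.lo_le
  le_hi := h.le_hi.trans (by omega)
  mono := by
    intro i hi' j hj hij
    have h1 : i ≤ hi := by have := hj.2; omega
    have h2 := h.le_last hi'.1 h1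
    simp only [if_pos h1]
    split_ifs with h3
    · exact h.mono ⟨hi'.1, h1⟩ ⟨hj.1, h3⟩ hij
    · omega
  apply_lo := by rw [if_pos h.lo_le_hi, h.apply_lo]
  apply_hi := by rw [if_neg (by omega)]

theorem extend_zero (h : IsValueSeq n r lo hi) :
    IsValueSeq (n + 1) (fun j => if lo ≤ j then r j + 1 else 1) (lo - 1) hi where
  lo_le := by have := h.lo_le; omega
  le_hi := h.le_hi
  mono := by
    intro i hi' j hj hij
    have h1 : lo ≤ j := by have := hi'.1; omega
    have h2 := h.one_le h1 hj.2
    simp only [if_pos h1]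
    split_ifs with h3
    · have := h.mono ⟨h3, hi'.2⟩ ⟨h1, hj.2⟩ hij
      omega
    · omega
  apply_lo := by rw [if_neg (by omega)]
  apply_hi := by rw [if_pos h.lo_le_hi, h.apply_hi]

end IsValueSeq

/-- The product over the gaps between consecutive record values. -/
noncomputable def gapProd (s r : ℤ → ℕ) (lo hi : ℤ) : ℕ :=
  ∏ j ∈ Finset.Ico lo hi, Nat.choose (s (j + 1) - s j - 1) (r (j + 1) - r j - 1)

theorem gapProd_extend_max (s : ℤ → ℕ) {n : ℕ} {r : ℤ → ℕ} {lo hi : ℤ}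
    (h : IsValueSeq n r lo hi) :
    gapProd s (fun j => if j ≤ hi then r j else n + 1) lo (hi + 1) = gapProd s r lo hi := by
  have h1 : Finset.Ico lo (hi + 1) = insert hi (Finset.Ico lo hi) := by
    have := h.lo_le_hi
    ext j
    simp only [mem_Ico, mem_insert]
    omega
  rw [gapProd, h1, prod_insert (by simp), if_neg (by omega), if_pos le_rfl, h.apply_hi,
    Nat.add_sub_cancel_left, Nat.sub_self, Nat.choose_zero_right, one_mul, gapProd]
  refine prod_congr rfl fun j hj => ?_
  rw [mem_Ico] at hj
  rw [if_pos (by omega), if_pos (by omega)]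

theorem gapProd_extend_zero (s : ℤ → ℕ) {n : ℕ} {r : ℤ → ℕ} {lo hi : ℤ}
    (h : IsValueSeq n r lo hi) :
    gapProd s (fun j => if lo ≤ j then r j + 1 else 1) (lo - 1) hi = gapProd s r lo hi := by
  have h1 : Finset.Ico (lo - 1) hi = insert (lo - 1) (Finset.Ico lo hi) := by
    have := h.lo_le_hi
    ext j
    simp only [mem_Ico, mem_insert]
    omega
  rw [gapProd, h1, prod_insert (by simp), sub_add_cancel, if_pos le_rfl, if_neg (by omega),
    h.apply_lo, Nat.add_sub_cancel_left, Nat.sub_self, Nat.choose_zero_right, one_mul, gapProd]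
  refine prod_congr rfl fun j hj => ?_
  rw [mem_Ico] at hj
  rw [if_pos (by omega), if_pos (by omega), Nat.add_sub_add_right]

theorem mul_choose_eq {S R : ℕ} (hS : 1 ≤ S) (hR : 1 ≤ R) :
    (R : ℤ) * Nat.choose (S - 1) R = (S - R) * Nat.choose (S - 1) (R - 1) := by
  obtain ⟨S, rfl⟩ := Nat.exists_eq_add_of_le' hS
  obtain ⟨R, rfl⟩ := Nat.exists_eq_add_of_le' hR
  simp only [Nat.add_sub_cancel]
  have h1 := Nat.choose_succ_right_eq S R
  rcases le_or_gt R S with h | h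
  · zify [h] at h1
    push_cast
    linarith
  · rw [Nat.choose_eq_zero_of_lt h, Nat.choose_eq_zero_of_lt (by omega)]
    simp

theorem gapProd_shift {s : ℤ → ℕ} {n : ℕ} {r : ℤ → ℕ} {lo hi : ℤ} (h : IsValueSeq n r lo hi)
    {j : ℤ} (hlo : lo ≤ j) (hhi : j < hi) (hs : s j < s (j + 1)) {v : ℕ}
    (hv : v ∈ Finset.Ico (r j) (r (j + 1))) :
    ((r (j + 1) : ℤ) - r j) * gapProd s (fun i => shiftAbove v (r i)) lo hi =
      (((s (j + 1) : ℤ) - s j) - (r (j + 1) - r j)) * gapProd s r lo hi := by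
  have hr := h.lt_succ hlo hhi
  rw [mem_Ico] at hv
  have hmem : j ∈ Finset.Ico lo hi := mem_Ico.2 ⟨hlo, hhi⟩
  unfold gapProd
  rw [← mul_prod_erase _ _ hmem, ← mul_prod_erase (a := j) _ (fun j =>
    Nat.choose (s (j + 1) - s j - 1) (r (j + 1) - r j - 1)) hmem]
  have e1 : ∏ i ∈ (Finset.Ico lo hi).erase j, Nat.choose (s (i + 1) - s i - 1)
      (shiftAbove v (r (i + 1)) - shiftAbove v (r i) - 1) =
      ∏ i ∈ (Finset.Ico lo hi).erase j, Nat.choose (s (i + 1) - s i - 1)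
      (r (i + 1) - r i - 1) := by
    refine prod_congr rfl fun i hi' => ?_
    simp only [mem_erase, mem_Ico] at hi'
    obtain ⟨h1, h2, h3⟩ := hi'
    congr 2
    rcases lt_or_gt_of_ne h1 with h4 | h4
    · have := h.mono.monotoneOn ⟨by omega, by omega⟩ ⟨hlo, hhi.le⟩ (show i + 1 ≤ j by omega)
      have := h.lt_succ h2 h3
      rw [shiftAbove, shiftAbove, if_pos (by omega), if_pos (by omega)]
    · have := h.mono.monotoneOn ⟨by omega, by omega⟩ ⟨by omega, by omega⟩
        (show j + 1 ≤ i by omega)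
      have := h.lt_succ h2 h3
      rw [shiftAbove, shiftAbove, if_neg (by omega), if_neg (by omega)]
      omega
  have e2 : shiftAbove v (r (j + 1)) - shiftAbove v (r j) - 1 = r (j + 1) - r j := by
    rw [shiftAbove, shiftAbove, if_neg (by omega), if_pos (by omega)]
    omega
  have e3 := mul_choose_eq (S := s (j + 1) - s j) (R := r (j + 1) - r j) (by omega) (by omega)
  rw [Nat.cast_sub hr.le, Nat.cast_sub hs.le] at e3
  rw [e1, e2]
  push_cast
  rw [← mul_assoc, e3]
  ring

theorem coherentCount_self_mul {n : ℕ} (hn : 0 < n) {s : ℤ → ℕ} {Lo Hi : ℤ}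
    (hs : IsValueSeq n s Lo Hi) {Q : Equiv.Perm (Fin n) → Prop} [DecidablePred Q]
    (hQ : ∀ π', Q π' ↔ IsRecordSeq hn π' s Lo Hi) {π : Equiv.Perm (Fin n)} {r : ℤ → ℕ}
    {lo hi : ℤ} (hlo : Lo ≤ lo) (hhi : hi ≤ Hi) (hr : IsValueSeq n r lo hi)
    (hπ : IsRecordSeq hn π r lo hi) :
    coherentCount le_rfl π Q * (∏ k ∈ Finset.Ico hi Hi, (n - s k)) *
      (∏ k ∈ Finset.Ioc Lo lo, (s k - 1)) = gapProd s r lo hi := by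
  have hcount : coherentCount le_rfl π Q = if Q π then 1 else 0 := by
    unfold coherentCount
    simp only [coherentWith_self_iff]
    rw [← filter_filter, filter_eq', if_pos (mem_univ _), filter_singleton]
    split_ifs <;> simp
  have hle := hr.lo_le_hi
  by_cases hgap : ∀ j, lo ≤ j → j < hi → r (j + 1) - r j ≤ s (j + 1) - s j
  · have tele : ∀ k : ℕ, ∀ i, lo ≤ i → i + k ≤ hi →
        (r (i + k) : ℤ) - r i ≤ s (i + k) - s i := by
      intro k
      induction k with
      | zero => simp
      | succ k ih =>
        intro i h1 h2
        push_cast at h2 ⊢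
        have h3 := ih i h1 (by omega)
        have h4 := hgap (i + k) (by omega) (by omega)
        have h5 := hr.lt_succ (j := i + k) (by omega) (by omega)
        have h6 := hs.lt_succ (j := i + k) (by omega) (by omega)
        rw [add_assoc] at h4 h5 h6
        omega
    have tele' : ∀ i j, lo ≤ i → i ≤ j → j ≤ hi → (r j : ℤ) - r i ≤ s j - s i := by
      intro i j h1 h2 h3
      obtain ⟨k, rfl⟩ := Int.le.dest h2
      exact tele k i h1 h3
    have h1 := hs.one_le hlo (hle.trans hhi)
    have h2 := hs.le_last (hlo.trans hle) hhi
    have h3 := tele' lo hi le_rfl hle le_rfl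
    rw [hr.apply_hi, hr.apply_lo] at h3
    have heq : ∀ j, lo ≤ j → j ≤ hi → r j = s j := by
      intro j hj hj'
      have h4 := tele' lo j le_rfl hj hj'
      have h5 := tele' j hi hj hj' le_rfl
      rw [hr.apply_lo] at h4
      rw [hr.apply_hi] at h5
      omega
    obtain rfl : Lo = lo := hs.mono.injOn ⟨le_rfl, hs.lo_le_hi⟩ ⟨hlo, hle.trans hhi⟩
      (by rw [hs.apply_lo]; omega)
    obtain rfl : hi = Hi := hs.mono.injOn ⟨hle, hhi⟩ ⟨hs.lo_le_hi, le_rfl⟩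
      (by rw [hs.apply_hi]; omega)
    have hQπ : Q π := by
      rw [hQ]
      refine ⟨?_, ?_, ?_⟩
      · rw [hπ.center, heq 0 hr.lo_le hr.le_hi]
      · rw [hπ.lower]
        refine image_congr fun j hj => ?_
        rw [coe_Icc] at hj
        exact heq j hj.1 (hj.2.trans hr.le_hi)
      · rw [hπ.upper]
        refine image_congr fun j hj => ?_
        rw [coe_Icc] at hj
        exact heq j (hr.lo_le.trans hj.1) hj.2
    rw [hcount, if_pos hQπ, Finset.Ico_self, Finset.Ioc_self, prod_empty, prod_empty, mul_one, mul_one,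
      eq_comm]
    refine prod_eq_one ?_
    intro j hj
    rw [mem_Ico] at hj
    rw [heq j hj.1 hj.2.le, heq (j + 1) (by omega) (by omega), Nat.choose_self]
  · push Not at hgap
    obtain ⟨j, h1, h2, h3⟩ := hgap
    have h4 := hs.lt_succ (j := j) (by omega) (by omega)
    have hQπ : ¬ Q π := by
      rw [hQ]
      intro h
      obtain ⟨-, -, h5⟩ := hπ.unique h hr.lo_le hr.le_hi hs.lo_le hs.le_hi hr.mono hs.mono
      rw [h5 ⟨h1, h2.le⟩, h5 ⟨by omega, by omega⟩] at h3
      exact h3.false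
    rw [hcount, if_neg hQπ, zero_mul, zero_mul, gapProd, eq_comm]
    exact prod_eq_zero (mem_Ico.2 ⟨h1, h2⟩) (Nat.choose_eq_zero_of_lt (by omega))

theorem coherentCount_mul {m : ℕ} (hm : 0 < m) {s : ℤ → ℕ} {Lo Hi : ℤ}
    (hs : IsValueSeq m s Lo Hi) {Q : Equiv.Perm (Fin m) → Prop} [DecidablePred Q]
    (hQ : ∀ π', Q π' ↔ IsRecordSeq hm π' s Lo Hi) (d : ℕ) :
    ∀ {n : ℕ} (hn : 0 < n) (hnm : n ≤ m) (_ : n + d = m) (π : Equiv.Perm (Fin n)) (r : ℤ → ℕ)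
      (lo hi : ℤ), Lo ≤ lo → hi ≤ Hi → IsValueSeq n r lo hi → IsRecordSeq hn π r lo hi →
      coherentCount hnm π Q * (∏ k ∈ Finset.Ico hi Hi, (m - s k)) *
        (∏ k ∈ Finset.Ioc Lo lo, (s k - 1)) = d.factorial * gapProd s r lo hi := by
  induction d with
  | zero =>
    intro n hn hnm hd π r lo hi hlo hhi hr hπ
    obtain rfl : n = m := by omega
    rw [Nat.factorial_zero, one_mul]
    exact coherentCount_self_mul hn hs hQ hlo hhi hr hπ
  | succ d ih =>
    intro n hn hnm hd π r lo hi hlo hhi hr hπ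
    have hlt : n < m := by omega
    have hle := hr.lo_le_hi
    set P := (∏ k ∈ Finset.Ico hi Hi, (m - s k)) * ∏ k ∈ Finset.Ioc Lo lo, (s k - 1) with hP
    set G := gapProd s r lo hi with hG
    let N : ℕ → ℕ := fun w => if h : w < n + 1 then
      coherentCount (Nat.succ_le_of_lt hlt) (insertLast π ⟨w, h⟩) Q else 0
    have hN : ∀ v : Fin (n + 1),
        coherentCount (Nat.succ_le_of_lt hlt) (insertLast π v) Q = N v := fun v => by
      simp only [N, dif_pos v.isLt]
    have hmax : (N n : ℤ) * P = d.factorial * G * ((m : ℤ) - s hi) := by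
      have e := hN (Fin.last n)
      rw [Fin.val_last] at e
      have h1 := hπ.insertLast_max hr.le_hi fun j hj => hr.le_last hj.1 hj.2
      have hsm := hs.le_last (hlo.trans hle) hhi
      rw [← e]
      rcases hhi.lt_or_eq with h2 | rfl
      · have h3 := ih n.succ_pos (Nat.succ_le_of_lt hlt) (by omega) _ _ lo (hi + 1) hlo
          (by omega) hr.extend_max h1
        rw [gapProd_extend_max s hr, ← hG] at h3
        have h4 : Finset.Ico hi Hi = insert hi (Finset.Ico (hi + 1) Hi) := by
          ext j
          simp only [mem_Ico, mem_insert]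
          omega
        rw [hP, h4, prod_insert (by simp), ← Nat.cast_sub hsm]
        norm_cast
        rw [← h3]
        ring
      · rw [hs.apply_hi, sub_self, mul_zero]
        suffices h2 : coherentCount (Nat.succ_le_of_lt hlt) (insertLast π (Fin.last n)) Q = 0 by
          rw [h2]
          simp
        rw [coherentCount, card_eq_zero, filter_eq_empty_iff]
        rintro π' - ⟨h2, h3⟩
        have h4 := h2.card_upperRecValues_le
        rw [((hQ π').1 h3).card_upper hs.lo_le hs.mono,
          h1.card_upper hr.lo_le hr.extend_max.mono] at h4
        have := hr.le_hi
        omega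
    have hzero : (N 0 : ℤ) * P = d.factorial * G * ((s lo : ℤ) - 1) := by
      have e := hN 0
      rw [Fin.val_zero] at e
      have h1 := hπ.insertLast_zero hr.lo_le fun j hj =>
        (Nat.one_le_iff_ne_zero.1 (hr.one_le hj.1 hj.2))
      have hs1 := hs.one_le hlo (hle.trans hhi)
      rw [← e]
      rcases hlo.lt_or_eq with h2 | rfl
      · have h3 := ih n.succ_pos (Nat.succ_le_of_lt hlt) (by omega) _ _ (lo - 1) hi
          (by omega) hhi hr.extend_zero h1
        rw [gapProd_extend_zero s hr, ← hG] at h3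
        have h4 : Finset.Ioc Lo lo = insert lo (Finset.Ioc Lo (lo - 1)) := by
          ext j
          simp only [mem_Ioc, mem_insert]
          omega
        rw [hP, h4, prod_insert (by simp), ← Nat.cast_pred hs1]
        norm_cast
        rw [← h3]
        ring
      · rw [hs.apply_lo, Nat.cast_one, sub_self, mul_zero]
        suffices h2 : coherentCount (Nat.succ_le_of_lt hlt) (insertLast π 0) Q = 0 by
          rw [h2]
          simp
        rw [coherentCount, card_eq_zero, filter_eq_empty_iff]
        rintro π' - ⟨h2, h3⟩
        have h4 := h2.card_lowerRecValues_le
        rw [((hQ π').1 h3).card_lower hs.le_hi hs.mono,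
          h1.card_lower hr.le_hi hr.extend_zero.mono] at h4
        have := hr.lo_le
        omega
    have hgap : ∀ j, lo ≤ j → j < hi →
        ∑ v ∈ Finset.Ico (r j) (r (j + 1)), (N v : ℤ) * P =
          d.factorial * G * (((s (j + 1) : ℤ) - s j) - (r (j + 1) - r j)) := by
      intro j h1 h2
      have hrj := hr.lt_succ h1 h2
      have hsj := hs.lt_succ (hlo.trans h1) (h2.trans_le hhi)
      have hpos : (0 : ℤ) < (r (j + 1) : ℤ) - r j := by omega
      apply mul_left_cancel₀ hpos.ne'
      have hcard : (r (j + 1) : ℤ) - r j = (Finset.Ico (r j) (r (j + 1))).card := by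
        rw [Nat.card_Ico, Nat.cast_sub hrj.le]
      rw [mul_sum]
      conv_rhs =>
        lhs
        rw [hcard]
      rw [← nsmul_eq_mul]
      refine sum_eq_card_nsmul fun v hv => ?_
      have hv' := mem_Ico.1 hv
      have hv0 : v ≠ 0 := by
        have := hr.one_le h1 h2.le
        omega
      have hvn : v < n := hv'.2.trans_le (hr.le_last (by omega) (by omega))
      have h3 := ih n.succ_pos (Nat.succ_le_of_lt hlt) (by omega) _ _ lo hi hlo hhi
        (hr.shift hv0 hvn) (hπ.insertLast_mid (v := ⟨v, by omega⟩) hv0 hvn.ne)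
      rw [hN, mul_assoc, ← hP] at h3
      have h4 := gapProd_shift hr h1 h2 hsj hv
      rw [← hG] at h4
      rw [← Nat.cast_mul, h3, Nat.cast_mul, mul_left_comm, h4]
      ring
    have hmid : ∀ k : ℕ, lo + k ≤ hi → ∑ v ∈ Finset.Ico 1 (r (lo + k)), (N v : ℤ) * P =
        d.factorial * G * (((s (lo + k) : ℤ) - s lo) - (r (lo + k) - 1)) := by
      intro k
      induction k with
      | zero => simp [hr.apply_lo]
      | succ k ih =>
        intro h1
        push_cast at h1 ⊢
        have h2 := ih (by omega)
        have h3 := hgap (lo + k) (by omega) (by omega)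
        have h4 := hr.lt_succ (j := lo + k) (by omega) (by omega)
        rw [← add_assoc, ← sum_Ico_consecutive _ (hr.one_le (by omega) (by omega)) h4.le, h2, h3]
        ring
    obtain ⟨k, hk⟩ := Int.le.dest hle
    have hmid' := hmid k hk.le
    rw [hk, hr.apply_hi] at hmid'
    have hsum : coherentCount hnm π Q = N 0 + ∑ v ∈ Finset.Ico 1 n, N v + N n := by
      rw [coherentCount_eq_sum hlt, sum_congr rfl fun v _ => hN v, Fin.sum_univ_eq_sum_range,
        sum_range_succ, range_eq_Ico, sum_eq_sum_Ico_succ_bot hn]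
    rw [mul_assoc, ← hP, hsum, Nat.factorial_succ]
    zify
    rw [add_mul, add_mul, hmax, hzero, sum_mul, hmid']
    have hd' : (m : ℤ) = n + (d + 1) := by exact_mod_cast hd.symm
    rw [hd']
    ring

theorem gapProd_eq_prod_partsOf (s r : ℤ → ℕ) {lo hi : ℤ} (hlo : lo ≤ 0) (hhi : 0 ≤ hi) :
    gapProd s r lo hi =
      ∏ k ∈ Finset.Icc lo hi, Nat.choose (partsOf s k - 1) (partsOf r k - 1) := by
  rw [← mul_prod_erase _ _ (mem_Icc.2 ⟨hlo, hhi⟩)]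
  have h0 : ∀ t : ℤ → ℕ, partsOf t 0 = 1 := fun t => by simp [partsOf]
  rw [h0, h0, Nat.sub_self, Nat.choose_self, one_mul, gapProd]
  refine prod_bij (fun j _ => if 0 ≤ j then j + 1 else j) ?_ ?_ ?_ ?_
  · intro j hj
    simp only [mem_Ico, mem_erase, mem_Icc] at hj ⊢
    split_ifs <;> omega
  · intro i _ j _ h
    split_ifs at h <;> omega
  · intro k hk
    simp only [mem_erase, mem_Icc] at hk
    refine ⟨if 0 < k then k - 1 else k, ?_, ?_⟩
    · rw [mem_Ico]
      split_ifs <;> omega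
    · split_ifs <;> omega
  · intro j _
    have h1 : ∀ t : ℤ → ℕ, partsOf t (if 0 ≤ j then j + 1 else j) = t (j + 1) - t j := by
      intro t
      unfold partsOf
      split_ifs <;> first | omega | simp
    rw [h1, h1]

/-- counting permutations of `{1,…,m}` coherent with a given `π` and with
prescribed two-sided record values `s`:
`N ⬝ ∏_{k=1}^{a}(m − s_{u+k−1}) ⬝ ∏_{k=1}^{b}(s_{−ℓ−k+1} − 1)
  = (m−n)! ⬝ ∏_{k=−ℓ}^{u} C(μ_k − 1, λ_k − 1)`. -/
theorem stmt_6 (n m ℓ u a b : ℕ) (hn : 0 < n) (hnm : n < m)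
    (π : Equiv.Perm (Fin n)) (r s : ℤ → ℕ)
    (hrmono : StrictMonoOn r (Set.Icc (-(ℓ : ℤ)) (u : ℤ)))
    (hr1 : r (-(ℓ : ℤ)) = 1) (hrn : r (u : ℤ) = n)
    (hcenter : (π ⟨0, hn⟩).val + 1 = r 0)
    (hlow : lowerRecValues π = (Finset.Icc (-(ℓ : ℤ)) 0).image r)
    (hup : upperRecValues π = (Finset.Icc (0 : ℤ) (u : ℤ)).image r)
    (hsmono : StrictMonoOn s (Set.Icc (-(ℓ : ℤ) - (b : ℤ)) ((u : ℤ) + (a : ℤ))))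
    (hs1 : s (-(ℓ : ℤ) - (b : ℤ)) = 1) (hsm : s ((u : ℤ) + (a : ℤ)) = m) :
    (univ.filter fun π' : Equiv.Perm (Fin m) =>
        CoherentWith (le_of_lt hnm) π' π ∧
        (π' ⟨0, hn.trans hnm⟩).val + 1 = s 0 ∧
        lowerRecValues π' = (Finset.Icc (-(ℓ : ℤ) - (b : ℤ)) 0).image s ∧
        upperRecValues π' = (Finset.Icc (0 : ℤ) ((u : ℤ) + (a : ℤ))).image s).card
      * (∏ k ∈ Finset.range a, (m - s ((u : ℤ) + (k : ℤ))))
      * (∏ k ∈ Finset.range b, (s (-(ℓ : ℤ) - (k : ℤ)) - 1))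
      = Nat.factorial (m - n) *
        ∏ k ∈ Finset.Icc (-(ℓ : ℤ)) (u : ℤ), Nat.choose (partsOf s k - 1) (partsOf r k - 1) := by
  have hs : IsValueSeq m s (-(ℓ : ℤ) - b) (u + a) :=
    ⟨by omega, by omega, hsmono, hs1, hsm⟩
  have hr : IsValueSeq n r (-(ℓ : ℤ)) u := ⟨by omega, by omega, hrmono, hr1, hrn⟩
  have key := coherentCount_mul (hn.trans hnm) hs
    (Q := fun π' => (π' ⟨0, hn.trans hnm⟩).val + 1 = s 0 ∧
        lowerRecValues π' = (Finset.Icc (-(ℓ : ℤ) - (b : ℤ)) 0).image s ∧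
        upperRecValues π' = (Finset.Icc (0 : ℤ) ((u : ℤ) + (a : ℤ))).image s)
    (fun π' => ⟨fun h => ⟨h.1, h.2.1, h.2.2⟩, fun h => ⟨h.center, h.lower, h.upper⟩⟩)
    (m - n) hn hnm.le (by omega) π r (-(ℓ : ℤ)) u (by omega) (by omega) hr
    ⟨hcenter, hlow, hup⟩
  have e1 : ∏ k ∈ Finset.Ico (u : ℤ) (u + a), (m - s k) =
      ∏ k ∈ Finset.range a, (m - s ((u : ℤ) + (k : ℤ))) := by
    symm
    refine prod_bij (fun k _ => (u : ℤ) + k) ?_ ?_ ?_ fun _ _ => rfl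
    · intro k hk
      simp only [mem_range, mem_Ico] at hk ⊢
      omega
    · intro i _ j _ h
      omega
    · intro j hj
      rw [mem_Ico] at hj
      exact ⟨(j - u).toNat, by rw [mem_range]; omega, by omega⟩
  have e2 : ∏ k ∈ Finset.Ioc (-(ℓ : ℤ) - b) (-(ℓ : ℤ)), (s k - 1) =
      ∏ k ∈ Finset.range b, (s (-(ℓ : ℤ) - (k : ℤ)) - 1) := by
    symm
    refine prod_bij (fun k _ => -(ℓ : ℤ) - k) ?_ ?_ ?_ fun _ _ => rfl
    · intro k hk
      simp only [mem_range, mem_Ioc] at hk ⊢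
      omega
    · intro i _ j _ h
      omega
    · intro j hj
      rw [mem_Ioc] at hj
      exact ⟨(-ℓ - j).toNat, by rw [mem_range]; omega, by omega⟩
  rw [e1, e2, gapProd_eq_prod_partsOf s r (by omega) (by omega)] at key
  exact key
end

section
/- Let P be a probability measure on Ω = ∏_{n≥1} {1,…,n} such that for every n the cylinder probability P(ω_1 = i_1, …, ω_n = i_n) depends on (i_1,…,i_n) only through #{2 ≤ j ≤ n : i_j = 1} (equivalently, each random permutation π_n is conditionally uniform given its number of lower records). For θ ∈ [0,∞) let Q^θ be the probability measure on Ω under which the coordinates are independent, ω_1 = 1, and for n ≥ 2: Q^θ(ω_n = 1) = θ/(θ+n−1) and Q^θ(ω_n = r) = 1/(θ+n−1) for 2 ≤ r ≤ n; let Q^∞ be the point mass at the sequence with ω_n = 1 for all n. Then there exists a unique probability measure ν on [0,∞] such that P(E) = ∫_{[0,∞]} Q^θ(E) dν(θ) for every cylinder event E. -/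
open MeasureTheory ENNReal

/-- the space `Ω = ∏_{n≥1} {1,…,n}` of sequences of initial ranks: the coordinate of
index `k` (0-based) encodes `ω_{k+1} ∈ {1,…,k+1}` as an element of `Fin (k+1)`
(value `v` encodes rank `v+1`; rank `1`, i.e. `v = 0`, marks a lower record and
rank `k+1`, i.e. `v = k`, marks an upper record). -/
abbrev RankSpace := (k : ℕ) → Fin (k + 1)

/-- cylinder event `{ω_1 = i_1, …, ω_n = i_n}` -/
def rankCyl {n : ℕ} (i : (j : Fin n) → Fin (j.val + 1)) : Set RankSpace :=
  {ω | ∀ j : Fin n, ω j.val = i j}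

/-- the `Q^θ`-probability (`θ ∈ [0,∞]`) that the coordinate of index `j` equals `v`:
for `j ≥ 1` (i.e. `n = j+1 ≥ 2`) it is `θ/(θ+j)` for rank `1` and `1/(θ+j)` otherwise;
`Q^∞` is the point mass on the all-lower-records sequence. -/
noncomputable def ewensLowWt (θ : ℝ≥0∞) (j : ℕ) (v : Fin (j + 1)) : ℝ≥0∞ :=
  if j = 0 then 1
  else if θ = ⊤ then (if v.val = 0 then 1 else 0)
  else if v.val = 0 then θ / (θ + (j : ℝ≥0∞))
  else 1 / (θ + (j : ℝ≥0∞))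

open Filter Topology

/-- Initial segments of length `N` of a sequence of initial ranks. -/
abbrev RankPrefix (N : ℕ) := (j : Fin N) → Fin (j.val + 1)

/-- The number of lower records of a prefix, the trivial one at index `0` excluded. -/
def lowerRecords {N : ℕ} (i : RankPrefix N) : ℕ :=
  (Finset.univ.filter fun j : Fin N => 1 ≤ j.val ∧ (i j).val = 0).card

/-- The harmonic sum `∑_{1 ≤ b < N} 1 / b`. -/
noncomputable def harmonicSum (N : ℕ) : ℝ := ∑ b : Fin N, 1 / (b.val : ℝ)

/-- Estimate of the parameter `θ` from a prefix of a sequence of ranks. -/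
noncomputable def thetaEst {N : ℕ} (i : RankPrefix N) : ℝ := lowerRecords i / harmonicSum N

/-- Real-valued version of `ewensLowWt` at a finite parameter. -/
noncomputable def lowWt (t : ℝ) (j : ℕ) (v : Fin (j + 1)) : ℝ :=
  if j = 0 then 1 else if v.val = 0 then t / (t + j) else 1 / (t + j)

namespace RankPrefix

variable {N : ℕ}

theorem lowerRecords_eq_sum (i : RankPrefix N) :
    lowerRecords i = ∑ j : Fin N, if 1 ≤ j.val ∧ (i j).val = 0 then 1 else 0 := by
  rw [lowerRecords, Finset.card_filter]

theorem lowerRecords_update (i : RankPrefix N) (a : Fin N) (x : Fin (a.val + 1)) :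
    lowerRecords (Function.update i a x) + (if 1 ≤ a.val ∧ (i a).val = 0 then 1 else 0)
      = lowerRecords i + (if 1 ≤ a.val ∧ x.val = 0 then 1 else 0) := by
  have h : ∑ j ∈ Finset.univ.erase a,
        (if 1 ≤ j.val ∧ (Function.update i a x j).val = 0 then 1 else 0)
      = ∑ j ∈ Finset.univ.erase a, (if 1 ≤ j.val ∧ (i j).val = 0 then 1 else 0) := by
    refine Finset.sum_congr rfl fun j hj => ?_
    rw [Function.update_of_ne (Finset.ne_of_mem_erase hj)]
  rw [lowerRecords_eq_sum, lowerRecords_eq_sum,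
    ← Finset.add_sum_erase _ _ (Finset.mem_univ a), h,
    ← Finset.add_sum_erase _ (fun j : Fin N => if 1 ≤ j.val ∧ (i j).val = 0 then 1 else 0)
      (Finset.mem_univ a), Function.update_self]
  ring

/-- Moving a record from index `a` to index `b` preserves the number of records. -/
theorem lowerRecords_move (i : RankPrefix N) {a b : Fin N} (hab : a ≠ b) (ha : 1 ≤ a.val)
    (hb : 1 ≤ b.val) (hia : i a = 0) (hib : i b ≠ 0) {v : Fin (a.val + 1)} (hv : v ≠ 0) :
    lowerRecords (Function.update (Function.update i a v) b 0) = lowerRecords i := by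
  have h1 := lowerRecords_update (Function.update i a v) b 0
  have h2 := lowerRecords_update i a v
  rw [Function.update_of_ne hab.symm] at h1
  have hib' : (i b).val ≠ 0 := fun h => hib (Fin.ext h)
  have hv' : v.val ≠ 0 := fun h => hv (Fin.ext h)
  have hia' : (i a).val = 0 := by rw [hia]; rfl
  simp [ha, hb, hib', hv', hia'] at h1 h2
  omega

theorem sum_ite_update {a : Fin N} {x x' : Fin (a.val + 1)} {f : RankPrefix N → ℝ}
    (hf : ∀ i, i a = x → f (Function.update i a x') = f i) :
    ∑ i : RankPrefix N, (if i a = x then f i else 0)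
      = ∑ i : RankPrefix N, (if i a = x' then f i else 0) := by
  rw [← Finset.sum_filter, ← Finset.sum_filter]
  refine Finset.sum_bij' (fun i _ => Function.update i a x') (fun i _ => Function.update i a x)
    ?_ ?_ ?_ ?_ ?_
  · intro i _; simp
  · intro i _; simp
  · intro i hi
    have : i a = x := by simpa using hi
    simp [← this]
  · intro i hi
    have : i a = x' := by simpa using hi
    simp [← this]
  · intro i hi
    exact (hf i (by simpa using hi)).symm

theorem sum_ite_update₂ {a b : Fin N} (hab : a ≠ b) {x x' : Fin (a.val + 1)}
    {y y' : Fin (b.val + 1)} {f : RankPrefix N → ℝ}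
    (hf : ∀ i, i a = x → i b = y → f (Function.update (Function.update i a x') b y') = f i) :
    ∑ i : RankPrefix N, (if i a = x ∧ i b = y then f i else 0)
      = ∑ i : RankPrefix N, (if i a = x' ∧ i b = y' then f i else 0) := by
  rw [← Finset.sum_filter, ← Finset.sum_filter]
  have key : ∀ (z z' : Fin (a.val + 1)) (w w' : Fin (b.val + 1)) (i : RankPrefix N),
      i a = z → i b = w →
      Function.update (Function.update (Function.update (Function.update i a z') b w') a z) b w
        = i := by
    intro z z' w w' i hz hw
    funext j
    by_cases hjb : j = b
    · subst hjb; simp [hw]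
    · by_cases hja : j = a
      · subst hja; simp [hjb, hz]
      · simp [hjb, hja]
  refine Finset.sum_bij' (fun i _ => Function.update (Function.update i a x') b y')
    (fun i _ => Function.update (Function.update i a x) b y) ?_ ?_ ?_ ?_ ?_
  · intro i _; simp [hab]
  · intro i _; simp [hab]
  · intro i hi
    obtain ⟨h1, h2⟩ : i a = x ∧ i b = y := by simpa using hi
    exact key _ _ _ _ i h1 h2
  · intro i hi
    obtain ⟨h1, h2⟩ : i a = x' ∧ i b = y' := by simpa using hi
    exact key _ _ _ _ i h1 h2
  · intro i hi
    obtain ⟨h1, h2⟩ : i a = x ∧ i b = y := by simpa using hi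
    exact (hf i h1 h2).symm

/-- A record at `a` can be exchanged with a record at `b`, each weighted by the number of
alternatives at the other index. -/
theorem sum_exchange {n : ℕ} {a b : Fin N} (ha : 1 ≤ a.val) (han : a.val < n) (hb : n ≤ b.val)
    {v : Fin (a.val + 1)} (hv : v ≠ 0) {f : RankPrefix N → ℝ}
    (hf : ∀ i i', lowerRecords i = lowerRecords i' →
      (∀ j : Fin N, j.val < n → j ≠ a → i j = i' j) → f i = f i') :
    ∑ i : RankPrefix N, (if i a = 0 ∧ i b ≠ 0 then f i else 0)
      = b.val * ∑ i : RankPrefix N, (if i a = v ∧ i b = 0 then f i else 0) := by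
  have hab : a ≠ b := by rintro rfl; omega
  have hsplit : ∀ i : RankPrefix N, (if i a = 0 ∧ i b ≠ 0 then f i else 0)
      = ∑ u ∈ Finset.univ.erase (0 : Fin (b.val + 1)),
          (if i a = 0 ∧ i b = u then f i else 0) := by
    intro i
    by_cases h : i a = 0
    · simp [h]
    · simp [h]
  simp_rw [hsplit]
  rw [Finset.sum_comm]
  have : ∀ u ∈ Finset.univ.erase (0 : Fin (b.val + 1)),
      ∑ i : RankPrefix N, (if i a = 0 ∧ i b = u then f i else 0)
        = ∑ i : RankPrefix N, (if i a = v ∧ i b = 0 then f i else 0) := by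
    intro u hu
    refine sum_ite_update₂ hab fun i hia hib => hf _ _ ?_ ?_
    · exact lowerRecords_move i hab ha (by omega) hia
        (by rw [hib]; exact Finset.ne_of_mem_erase hu) hv
    · intro j hj hja
      have hjb : j ≠ b := by rintro rfl; omega
      rw [Function.update_of_ne hjb, Function.update_of_ne hja]
  rw [Finset.sum_congr rfl this, Finset.sum_const, Finset.card_erase_of_mem (Finset.mem_univ _)]
  simp

theorem sum_indicator_lt_le (N n : ℕ) : ∑ b : Fin N, (if b.val < n then (1 : ℝ) else 0) ≤ n := by
  rw [Fin.sum_univ_eq_sum_range (fun b => if b < n then (1 : ℝ) else 0) N, ← Finset.sum_filter,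
    Finset.sum_const, nsmul_eq_mul, mul_one]
  have : (Finset.range N).filter (· < n) ⊆ Finset.range n := fun x hx => by
    simpa using (Finset.mem_filter.1 hx).2
  exact_mod_cast (Finset.card_le_card this).trans (Finset.card_range n).le

theorem lowerRecords_cast (i : RankPrefix N) :
    (lowerRecords i : ℝ) = ∑ b : Fin N, if 1 ≤ b.val ∧ i b = 0 then (1 : ℝ) else 0 := by
  rw [lowerRecords_eq_sum]
  push_cast
  refine Finset.sum_congr rfl fun b _ => ?_
  simp only [Fin.ext_iff, Fin.val_zero]

theorem sum_exchange_tail {n : ℕ} {a : Fin N} (ha : 1 ≤ a.val) (han : a.val < n)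
    {v : Fin (a.val + 1)} (hv : v ≠ 0) {f : RankPrefix N → ℝ}
    (hf : ∀ i i', lowerRecords i = lowerRecords i' →
      (∀ j : Fin N, j.val < n → j ≠ a → i j = i' j) → f i = f i') :
    ∑ i : RankPrefix N, (if i a = 0 then
        f i * ∑ b : Fin N, (if n ≤ b.val ∧ i b ≠ 0 then 1 / (b.val : ℝ) else 0) else 0)
      = ∑ i : RankPrefix N, (if i a = v then
        f i * ∑ b : Fin N, (if n ≤ b.val ∧ i b = 0 then (1 : ℝ) else 0) else 0) := by
  have h1 : ∀ i : RankPrefix N, (if i a = 0 then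
        f i * ∑ b : Fin N, (if n ≤ b.val ∧ i b ≠ 0 then 1 / (b.val : ℝ) else 0) else 0)
      = ∑ b : Fin N, if n ≤ b.val then
          1 / (b.val : ℝ) * (if i a = 0 ∧ i b ≠ 0 then f i else 0) else 0 := by
    intro i
    by_cases h : i a = 0
    · simp only [h, if_true, true_and, Finset.mul_sum]
      refine Finset.sum_congr rfl fun b _ => ?_
      by_cases hb : n ≤ b.val <;> by_cases hi : i b = 0 <;> simp [hb, hi, mul_comm]
    · simp [h]
  have h2 : ∀ i : RankPrefix N, (if i a = v then
        f i * ∑ b : Fin N, (if n ≤ b.val ∧ i b = 0 then (1 : ℝ) else 0) else 0)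
      = ∑ b : Fin N, if n ≤ b.val then (if i a = v ∧ i b = 0 then f i else 0) else 0 := by
    intro i
    by_cases h : i a = v
    · simp only [h, if_true, true_and, Finset.mul_sum]
      refine Finset.sum_congr rfl fun b _ => ?_
      by_cases hb : n ≤ b.val <;> by_cases hi : i b = 0 <;> simp [hb, hi]
    · simp [h]
  simp_rw [h1, h2]
  rw [Finset.sum_comm, Finset.sum_comm (s := (Finset.univ : Finset (RankPrefix N)))]
  refine Finset.sum_congr rfl fun b _ => ?_
  by_cases hb : n ≤ b.val
  · simp only [hb, if_true]
    rw [← Finset.mul_sum, sum_exchange ha han hb hv hf, ← mul_assoc, one_div_mul_cancel, one_mul]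
    have : 0 < b.val := by omega
    positivity
  · simp [hb]

theorem harmonicSum_sub_le {n M : ℕ} (hn : 1 ≤ n) (hM : 0 < M) (i : RankPrefix N) :
    |harmonicSum N - ∑ b : Fin N, (if n ≤ b.val ∧ i b ≠ 0 then 1 / (b.val : ℝ) else 0)|
      ≤ n + M + lowerRecords i / M := by
  have hterm : ∀ b : Fin N,
      0 ≤ 1 / (b.val : ℝ) - (if n ≤ b.val ∧ i b ≠ 0 then 1 / (b.val : ℝ) else 0) ∧
      1 / (b.val : ℝ) - (if n ≤ b.val ∧ i b ≠ 0 then 1 / (b.val : ℝ) else 0) ≤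
        (if b.val < n then (1 : ℝ) else 0) + (if b.val < M then (1 : ℝ) else 0)
          + (if 1 ≤ b.val ∧ i b = 0 then (1 : ℝ) else 0) / M := by
    intro b
    have hb0 : 0 ≤ 1 / (b.val : ℝ) := by positivity
    have hb1 : 1 / (b.val : ℝ) ≤ 1 := by
      rcases Nat.eq_zero_or_pos b.val with h | h
      · simp [h]
      · rw [div_le_one (by positivity)]; exact_mod_cast h
    have hnn : 0 ≤ (if b.val < M then (1 : ℝ) else 0) := by split_ifs <;> norm_num
    have hnn' : 0 ≤ (if 1 ≤ b.val ∧ i b = 0 then (1 : ℝ) else 0) / M := by positivity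
    have hnn'' : 0 ≤ (if b.val < n then (1 : ℝ) else 0) := by split_ifs <;> norm_num
    by_cases h : n ≤ b.val ∧ i b ≠ 0
    · rw [if_pos h]
      constructor <;> linarith
    · rw [if_neg h, sub_zero]
      refine ⟨hb0, ?_⟩
      by_cases hbn : b.val < n
      · rw [if_pos hbn]; linarith
      · by_cases hbM : b.val < M
        · rw [if_pos hbM]; linarith
        · have hib : i b = 0 := by
            by_contra hne
            exact h ⟨by omega, hne⟩
          rw [if_pos (show 1 ≤ b.val ∧ i b = 0 from ⟨by omega, hib⟩)]
          have : 1 / (b.val : ℝ) ≤ 1 / M :=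
            one_div_le_one_div_of_le (by positivity) (by exact_mod_cast not_lt.1 hbM)
          linarith [hnn, hnn'']
  rw [harmonicSum, ← Finset.sum_sub_distrib,
    abs_of_nonneg (Finset.sum_nonneg fun b _ => (hterm b).1)]
  refine (Finset.sum_le_sum fun b _ => (hterm b).2).trans ?_
  rw [Finset.sum_add_distrib, Finset.sum_add_distrib, ← Finset.sum_div, ← lowerRecords_cast]
  gcongr <;> exact sum_indicator_lt_le _ _

theorem lowerRecords_sub_le {n : ℕ} (hn : 1 ≤ n) (i : RankPrefix N) :
    |(lowerRecords i : ℝ) - ∑ b : Fin N, (if n ≤ b.val ∧ i b = 0 then (1 : ℝ) else 0)| ≤ n := by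
  have hterm : ∀ b : Fin N,
      0 ≤ (if 1 ≤ b.val ∧ i b = 0 then (1 : ℝ) else 0)
        - (if n ≤ b.val ∧ i b = 0 then (1 : ℝ) else 0) ∧
      (if 1 ≤ b.val ∧ i b = 0 then (1 : ℝ) else 0)
        - (if n ≤ b.val ∧ i b = 0 then (1 : ℝ) else 0) ≤ (if b.val < n then (1 : ℝ) else 0) := by
    intro b
    by_cases h1 : n ≤ b.val
    · have h3 : 0 ≤ (if b.val < n then (1 : ℝ) else 0) := by split_ifs <;> norm_num
      simpa [h1, hn.trans h1] using h3
    · by_cases h2 : 1 ≤ b.val ∧ i b = 0 <;> simp [h1, h2, not_le.1 h1]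
  rw [lowerRecords_cast, ← Finset.sum_sub_distrib,
    abs_of_nonneg (Finset.sum_nonneg fun b _ => (hterm b).1)]
  exact (Finset.sum_le_sum fun b _ => (hterm b).2).trans (sum_indicator_lt_le _ _)

theorem thetaEst_nonneg (i : RankPrefix N) : 0 ≤ thetaEst i := by
  unfold thetaEst harmonicSum; positivity

/-- A prefix distribution depending only on the number of lower records satisfies, up to a small
error, the exchange relation which characterizes `Q^θ` with `θ` replaced by its estimate. -/
theorem abs_sum_record_sub_le {n M : ℕ} (hM : 0 < M) (hH : 0 < harmonicSum N)
    {q : RankPrefix N → ℝ} (hq0 : ∀ i, 0 ≤ q i) (hq1 : ∑ i, q i = 1)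
    (hq : ∀ i i', lowerRecords i = lowerRecords i' → q i = q i')
    {a : Fin N} (ha : 1 ≤ a.val) (han : a.val < n) {v : Fin (a.val + 1)} (hv : v ≠ 0)
    {g : RankPrefix N → ℝ} (hg1 : ∀ i, |g i| ≤ 1)
    (hg : ∀ i i', lowerRecords i = lowerRecords i' →
      (∀ j : Fin N, j.val < n → j ≠ a → i j = i' j) → g i = g i') :
    |∑ i, (if i a = 0 then q i * (lowWt (thetaEst i) a v * g i) else 0)
      - ∑ i, (if i a = v then q i * (lowWt (thetaEst i) a 0 * g i) else 0)|
      ≤ (2 * n + M) / harmonicSum N + 1 / M := by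
  set H := harmonicSum N with hHdef
  have ha0 : a.val ≠ 0 := by omega
  have hv0 : v.val ≠ 0 := fun h => hv (Fin.ext h)
  have ha1 : (1 : ℝ) ≤ (a.val : ℝ) := by exact_mod_cast ha
  have hden : ∀ i : RankPrefix N, 1 ≤ thetaEst i + (a.val : ℝ) := fun i => by
    linarith [thetaEst_nonneg i]
  have htH : ∀ i : RankPrefix N, thetaEst i * H = lowerRecords i := fun i => by
    rw [thetaEst, ← hHdef, div_mul_cancel₀ _ hH.ne']
  let f : RankPrefix N → ℝ := fun i => q i * g i / ((thetaEst i + a.val) * H)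
  have hf : ∀ i i', lowerRecords i = lowerRecords i' →
      (∀ j : Fin N, j.val < n → j ≠ a → i j = i' j) → f i = f i' := by
    intro i i' h h'
    simp only [f, thetaEst]
    rw [hq i i' h, hg i i' h h', h]
  let R : RankPrefix N → ℝ := fun i =>
    ∑ b : Fin N, (if n ≤ b.val ∧ i b ≠ 0 then 1 / (b.val : ℝ) else 0)
  let K : RankPrefix N → ℝ := fun i =>
    ∑ b : Fin N, (if n ≤ b.val ∧ i b = 0 then (1 : ℝ) else 0)
  have hex : ∑ i : RankPrefix N, (if i a = 0 then f i * R i else 0)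
      = ∑ i : RankPrefix N, (if i a = v then f i * K i else 0) :=
    sum_exchange_tail ha han hv hf
  have e1 : ∀ i : RankPrefix N, q i * (lowWt (thetaEst i) a v * g i) = f i * H := by
    intro i
    have := hden i
    have h1 : thetaEst i + (a.val : ℝ) ≠ 0 := by positivity
    simp only [lowWt, ha0, hv0, if_false, f]
    field_simp
  have e2 : ∀ i : RankPrefix N, q i * (lowWt (thetaEst i) a 0 * g i)
      = f i * lowerRecords i := by
    intro i
    have := hden i
    have h1 : thetaEst i + (a.val : ℝ) ≠ 0 := by positivity
    rw [← htH]
    simp only [lowWt, ha0, if_false, f, Fin.val_zero, if_true]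
    field_simp
  have key : ∑ i, (if i a = 0 then q i * (lowWt (thetaEst i) a v * g i) else 0)
      - ∑ i, (if i a = v then q i * (lowWt (thetaEst i) a 0 * g i) else 0)
      = ∑ i : RankPrefix N, ((if i a = 0 then f i * (H - R i) else 0)
        - (if i a = v then f i * (lowerRecords i - K i) else 0)) := by
    have : ∑ i : RankPrefix N, ((if i a = 0 then f i * R i else 0)
        - (if i a = v then f i * K i else 0)) = 0 := by
      rw [Finset.sum_sub_distrib, hex, sub_self]
    rw [← Finset.sum_sub_distrib, ← sub_zero (∑ i : RankPrefix N, _), ← this,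
      ← Finset.sum_sub_distrib]
    refine Finset.sum_congr rfl fun i _ => ?_
    rw [e1, e2]
    split_ifs <;> ring
  rw [key]
  refine (Finset.abs_sum_le_sum_abs _ _).trans ?_
  suffices h : ∀ i : RankPrefix N, |(if i a = 0 then f i * (H - R i) else 0)
      - (if i a = v then f i * (lowerRecords i - K i) else 0)|
      ≤ q i * ((2 * n + M) / H + 1 / M) by
    refine (Finset.sum_le_sum fun i _ => h i).trans_eq ?_
    rw [← Finset.sum_mul, hq1, one_mul]
  intro i
  have hR : |H - R i| ≤ n + M + lowerRecords i / M := harmonicSum_sub_le (by omega) hM i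
  have hK : |(lowerRecords i : ℝ) - K i| ≤ n := lowerRecords_sub_le (by omega) i
  have hM' : (0 : ℝ) < M := by exact_mod_cast hM
  have hbound : |(if i a = 0 then f i * (H - R i) else 0)
      - (if i a = v then f i * (lowerRecords i - K i) else 0)|
      ≤ |f i| * (2 * n + M + lowerRecords i / M) := by
    refine (abs_sub _ _).trans ?_
    have b1 : |if i a = 0 then f i * (H - R i) else 0| ≤ |f i| * (n + M + lowerRecords i / M) := by
      split_ifs
      · rw [abs_mul]; gcongr
      · rw [abs_zero]; positivity
    have b2 : |if i a = v then f i * (lowerRecords i - K i) else 0| ≤ |f i| * n := by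
      split_ifs
      · rw [abs_mul]; gcongr
      · rw [abs_zero]; positivity
    linarith
  refine hbound.trans ?_
  have hfi : |f i| ≤ q i * (1 / ((thetaEst i + a.val) * H)) := by
    have := hden i
    have hpos : 0 < (thetaEst i + a.val) * H := by positivity
    simp only [f]
    rw [abs_div, abs_mul, abs_of_nonneg (hq0 i), abs_of_pos hpos, div_eq_mul_one_div]
    gcongr
    exact mul_le_of_le_one_right (hq0 i) (hg1 i)
  calc |f i| * (2 * n + M + lowerRecords i / M)
      ≤ q i * (1 / ((thetaEst i + a.val) * H)) * (2 * n + M + lowerRecords i / M) := by gcongr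
    _ = q i * ((2 * n + M) / ((thetaEst i + a.val) * H)
          + thetaEst i / (thetaEst i + a.val) * (1 / M)) := by
        have := hden i
        have h1 : thetaEst i + (a.val : ℝ) ≠ 0 := by positivity
        rw [← htH]
        field_simp
    _ ≤ q i * ((2 * n + M) / H + 1 / M) := by
        have h1 := hden i
        have h2 := thetaEst_nonneg i
        refine mul_le_mul_of_nonneg_left (add_le_add ?_ ?_) (hq0 i)
        · exact div_le_div_of_nonneg_left (by positivity) hH (le_mul_of_one_le_left hH.le h1)
        · refine mul_le_of_le_one_left (by positivity) ?_
          rw [div_le_one (by linarith)]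
          linarith

end RankPrefix

theorem lowWt_nonneg {t : ℝ} (ht : 0 ≤ t) (j : ℕ) (v : Fin (j + 1)) : 0 ≤ lowWt t j v := by
  unfold lowWt; split_ifs <;> positivity

theorem sum_lowWt {t : ℝ} (ht : 0 ≤ t) (j : ℕ) : ∑ v, lowWt t j v = 1 := by
  rcases Nat.eq_zero_or_pos j with rfl | hj
  · simp [lowWt]
  · have : (0 : ℝ) < j := by exact_mod_cast hj
    have h0 : t + (j : ℝ) ≠ 0 := by positivity
    rw [Fin.sum_univ_succ]
    simp only [lowWt, hj.ne', if_false, Fin.val_zero, if_true, Fin.val_succ,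
      Nat.add_eq_zero_iff, one_ne_zero, and_false, Finset.sum_const, Finset.card_univ,
      Fintype.card_fin, nsmul_eq_mul]
    field_simp

theorem lowWt_le_one {t : ℝ} (ht : 0 ≤ t) (j : ℕ) (v : Fin (j + 1)) : lowWt t j v ≤ 1 := by
  rw [← sum_lowWt ht j]
  exact Finset.single_le_sum (fun w _ => lowWt_nonneg ht j w) (Finset.mem_univ v)

namespace RankPrefix

variable {N : ℕ}

theorem abs_sum_swap_sub_le {n M : ℕ} (hM : 0 < M) (hH : 0 < harmonicSum N)
    {q : RankPrefix N → ℝ} (hq0 : ∀ i, 0 ≤ q i) (hq1 : ∑ i, q i = 1)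
    (hq : ∀ i i', lowerRecords i = lowerRecords i' → q i = q i')
    {a : Fin N} (han : a.val < n) (v v' : Fin (a.val + 1))
    {g : RankPrefix N → ℝ} (hg1 : ∀ i, |g i| ≤ 1)
    (hg : ∀ i i', lowerRecords i = lowerRecords i' →
      (∀ j : Fin N, j.val < n → j ≠ a → i j = i' j) → g i = g i') :
    |∑ i, (if i a = v then q i * (lowWt (thetaEst i) a v' * g i) else 0)
      - ∑ i, (if i a = v' then q i * (lowWt (thetaEst i) a v * g i) else 0)|
      ≤ (2 * n + M) / harmonicSum N + 1 / M := by
  have hε : 0 ≤ (2 * (n : ℝ) + M) / harmonicSum N + 1 / M := by positivity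
  by_cases hvv : v = v'
  · subst hvv; simpa using hε
  have ha : 1 ≤ a.val := by
    by_contra h
    have h1 := v.isLt
    have h2 := v'.isLt
    exact hvv (Fin.ext (by omega))
  by_cases hv : v = 0
  · subst hv
    exact abs_sum_record_sub_le hM hH hq0 hq1 hq ha han (Ne.symm hvv) hg1 hg
  by_cases hv' : v' = 0
  · subst hv'
    rw [abs_sub_comm]
    exact abs_sum_record_sub_le hM hH hq0 hq1 hq ha han hv hg1 hg
  have hwt : ∀ t, lowWt t a v' = lowWt t a v := by
    intro t
    have h1 : v.val ≠ 0 := fun h => hv (Fin.ext h)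
    have h2 : v'.val ≠ 0 := fun h => hv' (Fin.ext h)
    simp [lowWt, h1, h2]
  simp_rw [hwt]
  rw [sum_ite_update (x' := v'), sub_self, abs_zero]
  · exact hε
  · intro i hi
    have hrec : lowerRecords (Function.update i a v') = lowerRecords i := by
      have h := lowerRecords_update i a v'
      have h1 : v.val ≠ 0 := fun h => hv (Fin.ext h)
      have h2 : v'.val ≠ 0 := fun h => hv' (Fin.ext h)
      simpa [hi, h1, h2] using h
    rw [hq _ _ hrec, hg _ i hrec fun j _ hj => Function.update_of_ne hj _ _, thetaEst, thetaEst,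
      hrec]

theorem abs_sum_integrate_coord_le {n M : ℕ} (hM : 0 < M) (hH : 0 < harmonicSum N)
    {q : RankPrefix N → ℝ} (hq0 : ∀ i, 0 ≤ q i) (hq1 : ∑ i, q i = 1)
    (hq : ∀ i i', lowerRecords i = lowerRecords i' → q i = q i')
    {a : Fin N} (han : a.val < n) (v : Fin (a.val + 1))
    {g : RankPrefix N → ℝ} (hg1 : ∀ i, |g i| ≤ 1)
    (hg : ∀ i i', lowerRecords i = lowerRecords i' →
      (∀ j : Fin N, j.val < n → j ≠ a → i j = i' j) → g i = g i') :
    |∑ i, q i * (if i a = v then g i else 0) - ∑ i, q i * (lowWt (thetaEst i) a v * g i)|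
      ≤ n * ((2 * n + M) / harmonicSum N + 1 / M) := by
  have hε : 0 ≤ (2 * (n : ℝ) + M) / harmonicSum N + 1 / M := by positivity
  have h1 : ∑ i, q i * (if i a = v then g i else 0)
      = ∑ v', ∑ i, (if i a = v then q i * (lowWt (thetaEst i) a v' * g i) else 0) := by
    rw [Finset.sum_comm]
    refine Finset.sum_congr rfl fun i _ => ?_
    by_cases h : i a = v
    · simp only [h, if_true]
      rw [← Finset.mul_sum, ← Finset.sum_mul, sum_lowWt (thetaEst_nonneg i), one_mul]
    · simp [h]
  have h2 : ∑ i, q i * (lowWt (thetaEst i) a v * g i)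
      = ∑ v', ∑ i, (if i a = v' then q i * (lowWt (thetaEst i) a v * g i) else 0) := by
    rw [Finset.sum_comm]
    refine Finset.sum_congr rfl fun i _ => ?_
    simp
  rw [h1, h2, ← Finset.sum_sub_distrib]
  refine (Finset.abs_sum_le_sum_abs _ _).trans ?_
  refine (Finset.sum_le_card_nsmul _ _ _ fun v' _ =>
    abs_sum_swap_sub_le hM hH hq0 hq1 hq han v v' hg1 hg).trans ?_
  rw [Finset.card_univ, Fintype.card_fin, nsmul_eq_mul]
  refine mul_le_mul_of_nonneg_right ?_ hε
  exact_mod_cast han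

/-- The probability of a cylinder of length `n` is close to the expectation of its `Q^θ`
probability, with `θ` replaced by its estimate from a longer prefix. -/
theorem abs_sum_cylinder_sub_le {n M : ℕ} (hM : 0 < M) (hH : 0 < harmonicSum N) (hnN : n ≤ N)
    {q : RankPrefix N → ℝ} (hq0 : ∀ i, 0 ≤ q i) (hq1 : ∑ i, q i = 1)
    (hq : ∀ i i', lowerRecords i = lowerRecords i' → q i = q i') (c : RankSpace) :
    |∑ i, q i * (if ∀ j : Fin N, j.val < n → i j = c j then 1 else 0)
      - ∑ i, q i * ∏ j ∈ Finset.range n, lowWt (thetaEst i) j (c j)|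
      ≤ n * (n * ((2 * n + M) / harmonicSum N + 1 / M)) := by
  let G : ℕ → RankPrefix N → ℝ := fun m i =>
    (∏ j ∈ Finset.range m, lowWt (thetaEst i) j (c j)) *
      (if ∀ j : Fin N, m ≤ j.val → j.val < n → i j = c j then 1 else 0)
  have hstep : ∀ m ≤ n, |∑ i, q i * G 0 i - ∑ i, q i * G m i|
      ≤ m * (n * ((2 * n + M) / harmonicSum N + 1 / M)) := by
    intro m
    induction m with
    | zero => intro _; simp
    | succ m ih =>
      intro hm
      let a : Fin N := ⟨m, by omega⟩
      let g : RankPrefix N → ℝ := fun i =>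
        (∏ j ∈ Finset.range m, lowWt (thetaEst i) j (c j)) *
          (if ∀ j : Fin N, m + 1 ≤ j.val → j.val < n → i j = c j then 1 else 0)
      have hg1 : ∀ i, |g i| ≤ 1 := by
        intro i
        have h0 : 0 ≤ ∏ j ∈ Finset.range m, lowWt (thetaEst i) j (c j) :=
          Finset.prod_nonneg fun j _ => lowWt_nonneg (thetaEst_nonneg i) _ _
        have h1 : ∏ j ∈ Finset.range m, lowWt (thetaEst i) j (c j) ≤ 1 :=
          Finset.prod_le_one (fun j _ => lowWt_nonneg (thetaEst_nonneg i) _ _)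
            fun j _ => lowWt_le_one (thetaEst_nonneg i) _ _
        simp only [g]
        split_ifs
        · rwa [mul_one, abs_of_nonneg h0]
        · simp
      have hg : ∀ i i', lowerRecords i = lowerRecords i' →
          (∀ j : Fin N, j.val < n → j ≠ a → i j = i' j) → g i = g i' := by
        intro i i' h h'
        have : (∀ j : Fin N, m + 1 ≤ j.val → j.val < n → i j = c j) ↔
            (∀ j : Fin N, m + 1 ≤ j.val → j.val < n → i' j = c j) := by
          refine forall_congr' fun j => ?_
          refine imp_congr_right fun hmj => imp_congr_right fun hjn => ?_
          rw [h' j hjn]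
          rintro rfl
          exact absurd hmj (by simp [a])
        simp only [g, thetaEst, h, this]
      have hGm : ∀ i, G m i = if i a = c m then g i else 0 := by
        intro i
        have : (∀ j : Fin N, m ≤ j.val → j.val < n → i j = c j) ↔
            i a = c m ∧ ∀ j : Fin N, m + 1 ≤ j.val → j.val < n → i j = c j := by
          constructor
          · exact fun h => ⟨h a le_rfl hm, fun j hj hj' => h j (by omega) hj'⟩
          · rintro ⟨h1, h2⟩ j hj hj'
            rcases hj.eq_or_lt with h | h
            · obtain rfl : j = a := Fin.ext h.symm
              exact h1
            · exact h2 j h hj'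
        simp only [G, g, this]
        by_cases h : i a = c m <;> simp [h]
      have hGm' : ∀ i, G (m + 1) i = lowWt (thetaEst i) a (c m) * g i := by
        intro i
        simp only [G, g, Finset.prod_range_succ, a]
        ring
      have h : |∑ i, q i * G m i - ∑ i, q i * G (m + 1) i|
          ≤ n * ((2 * n + M) / harmonicSum N + 1 / M) := by
        simp only [hGm, hGm']
        exact abs_sum_integrate_coord_le hM hH hq0 hq1 hq (a := a) hm (c m) hg1 hg
      have := abs_sub_le (∑ i, q i * G 0 i) (∑ i, q i * G m i) (∑ i, q i * G (m + 1) i)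
      have ih' := ih (by omega)
      push_cast
      linarith
  have h := hstep n le_rfl
  have e0 : ∀ i, G 0 i = if ∀ j : Fin N, j.val < n → i j = c j then 1 else 0 := by
    intro i; simp [G]
  have en : ∀ i, G n i = ∏ j ∈ Finset.range n, lowWt (thetaEst i) j (c j) := by
    intro i
    simp only [G]
    rw [if_pos (fun j h1 h2 => absurd h2 (not_lt.2 h1)), mul_one]
  simpa only [e0, en] using h

end RankPrefix

theorem ewensLowWt_ofReal {t : ℝ} (ht : 0 ≤ t) (j : ℕ) (v : Fin (j + 1)) :
    ewensLowWt (ENNReal.ofReal t) j v = ENNReal.ofReal (lowWt t j v) := by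
  rcases Nat.eq_zero_or_pos j with rfl | hj
  · simp [ewensLowWt, lowWt]
  · have hj' : (0 : ℝ) < j := by exact_mod_cast hj
    have hpos : 0 < t + j := by positivity
    have hsum : ENNReal.ofReal t + (j : ℝ≥0∞) = ENNReal.ofReal (t + j) := by
      rw [ENNReal.ofReal_add ht hj'.le, ENNReal.ofReal_natCast]
    simp only [ewensLowWt, lowWt, hj.ne', if_false, ENNReal.ofReal_ne_top, hsum]
    split_ifs
    · rw [ENNReal.ofReal_div_of_pos hpos]
    · rw [ENNReal.ofReal_div_of_pos hpos, ENNReal.ofReal_one]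

theorem sum_ewensLowWt (θ : ℝ≥0∞) (j : ℕ) : ∑ v, ewensLowWt θ j v = 1 := by
  by_cases hθ : θ = ⊤
  · subst hθ
    rcases Nat.eq_zero_or_pos j with rfl | hj
    · simp [ewensLowWt]
    · rw [Fin.sum_univ_succ]
      simp [ewensLowWt, hj.ne']
  · rw [← ENNReal.ofReal_toReal hθ]
    simp_rw [ewensLowWt_ofReal ENNReal.toReal_nonneg]
    rw [← ENNReal.ofReal_sum_of_nonneg fun v _ => lowWt_nonneg ENNReal.toReal_nonneg _ _,
      sum_lowWt ENNReal.toReal_nonneg, ENNReal.ofReal_one]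

theorem ewensLowWt_le_one (θ : ℝ≥0∞) (j : ℕ) (v : Fin (j + 1)) : ewensLowWt θ j v ≤ 1 := by
  rw [← sum_ewensLowWt θ j]
  exact Finset.single_le_sum (fun _ _ => zero_le) (Finset.mem_univ v)

theorem continuous_ewensLowWt (j : ℕ) (v : Fin (j + 1)) :
    Continuous fun θ => ewensLowWt θ j v := by
  rcases Nat.eq_zero_or_pos j with rfl | hj
  · simpa [ewensLowWt] using continuous_const
  have hj0 : (j : ℝ≥0∞) ≠ 0 := by exact_mod_cast hj.ne'
  have hinv : Continuous fun θ : ℝ≥0∞ => (θ + (j : ℝ≥0∞))⁻¹ := by fun_prop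
  by_cases hv : v.val = 0
  · have : (fun θ => ewensLowWt θ j v) = fun θ => 1 - (j : ℝ≥0∞) * (θ + (j : ℝ≥0∞))⁻¹ := by
      funext θ
      by_cases hθ : θ = ⊤
      · simp [ewensLowWt, hθ, hv, hj.ne']
      · simp only [ewensLowWt, hj.ne', hθ, hv, if_false, if_true]
        have h0 : θ + (j : ℝ≥0∞) ≠ 0 := by simp [hj.ne']
        have ht : θ + (j : ℝ≥0∞) ≠ ⊤ := by simp [hθ]
        refine ENNReal.eq_sub_of_add_eq ?_ ?_
        · exact ENNReal.mul_ne_top (by simp) (ENNReal.inv_ne_top.2 h0)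
        · rw [← div_eq_mul_inv, ← ENNReal.add_div, ENNReal.div_self h0 ht]
    rw [this]
    have hmul : Continuous fun θ : ℝ≥0∞ => (j : ℝ≥0∞) * (θ + (j : ℝ≥0∞))⁻¹ :=
      (ENNReal.continuous_const_mul (by simp)).comp hinv
    exact (ENNReal.continuous_sub_left ENNReal.one_ne_top).comp hmul
  · have : (fun θ => ewensLowWt θ j v) = fun θ => (θ + (j : ℝ≥0∞))⁻¹ := by
      funext θ
      by_cases hθ : θ = ⊤
      · simp [ewensLowWt, hθ, hv, hj.ne']
      · simp [ewensLowWt, hθ, hv, hj.ne']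
    rw [this]
    exact hinv

theorem tendsto_harmonicSum : Tendsto harmonicSum atTop atTop := by
  have h : harmonicSum = fun N => ∑ b ∈ Finset.range N, 1 / (b : ℝ) := by
    funext N
    rw [harmonicSum, Fin.sum_univ_eq_sum_range (fun b => 1 / (b : ℝ)) N]
  rw [h, ← not_summable_iff_tendsto_nat_atTop_of_nonneg fun b => by positivity]
  exact Real.not_summable_one_div_natCast

/-- Restriction of a sequence of ranks to its first `N` coordinates. -/
def rankPrefix (N : ℕ) (ω : RankSpace) : RankPrefix N := fun j => ω j.val

theorem measurable_rankPrefix (N : ℕ) : Measurable (rankPrefix N) :=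
  measurable_pi_lambda _ fun j => measurable_pi_apply j.val

theorem rankPrefix_preimage_singleton {N : ℕ} (i : RankPrefix N) :
    rankPrefix N ⁻¹' {i} = rankCyl i := by
  ext ω
  simp [rankPrefix, rankCyl, funext_iff]

theorem lintegral_comp_rankPrefix (P : Measure RankSpace) {N : ℕ} (F : RankPrefix N → ℝ≥0∞) :
    ∫⁻ ω, F (rankPrefix N ω) ∂P = ∑ i, F i * P (rankCyl i) := by
  rw [← lintegral_map (measurable_of_finite F) (measurable_rankPrefix N), lintegral_fintype]
  refine Finset.sum_congr rfl fun i _ => ?_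
  rw [Measure.map_apply (measurable_rankPrefix N) (measurableSet_singleton i),
    rankPrefix_preimage_singleton]

theorem lintegral_comp_rankPrefix_ofReal (P : Measure RankSpace) [IsFiniteMeasure P] {N : ℕ}
    {F : RankPrefix N → ℝ} (hF : ∀ i, 0 ≤ F i) :
    ∫⁻ ω, ENNReal.ofReal (F (rankPrefix N ω)) ∂P
      = ENNReal.ofReal (∑ i, P.real (rankCyl i) * F i) := by
  rw [lintegral_comp_rankPrefix P fun i => ENNReal.ofReal (F i),
    ENNReal.ofReal_sum_of_nonneg fun i _ => mul_nonneg measureReal_nonneg (hF i)]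
  refine Finset.sum_congr rfl fun i _ => ?_
  rw [ENNReal.ofReal_mul measureReal_nonneg, ofReal_measureReal, mul_comm]

/-- The distribution under `P` of the parameter estimate based on the first `N` ranks. -/
noncomputable def thetaEstLaw (P : Measure RankSpace) (N : ℕ) : Measure ℝ≥0∞ :=
  P.map fun ω => ENNReal.ofReal (thetaEst (rankPrefix N ω))

theorem measurable_thetaEst_rankPrefix (N : ℕ) :
    Measurable fun ω => ENNReal.ofReal (thetaEst (rankPrefix N ω)) :=
  (measurable_of_finite fun i : RankPrefix N => ENNReal.ofReal (thetaEst i)).comp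
    (measurable_rankPrefix N)

instance (P : Measure RankSpace) [IsProbabilityMeasure P] (N : ℕ) :
    IsProbabilityMeasure (thetaEstLaw P N) :=
  Measure.isProbabilityMeasure_map (measurable_thetaEst_rankPrefix N).aemeasurable

theorem tendsto_lintegral_thetaEstLaw (P : Measure RankSpace) [IsProbabilityMeasure P]
    (hP : ∀ (n : ℕ) (i i' : RankPrefix n), lowerRecords i = lowerRecords i' →
      P (rankCyl i) = P (rankCyl i')) (n : ℕ) (c : RankSpace) :
    Tendsto (fun N => ∫⁻ θ, ∏ j ∈ Finset.range n, ewensLowWt θ j (c j) ∂thetaEstLaw P N) atTop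
      (𝓝 (P (rankCyl (rankPrefix n c)))) := by
  let A : ℕ → ℝ := fun N => ∑ i : RankPrefix N,
    P.real (rankCyl i) * ∏ j ∈ Finset.range n, lowWt (thetaEst i) j (c j)
  have hint : ∀ N, ∫⁻ θ, ∏ j ∈ Finset.range n, ewensLowWt θ j (c j) ∂thetaEstLaw P N
      = ENNReal.ofReal (A N) := by
    intro N
    have hmeas : Measurable fun θ => ∏ j ∈ Finset.range n, ewensLowWt θ j (c j) :=
      Finset.measurable_prod _ fun j _ => (continuous_ewensLowWt j (c j)).measurable
    rw [thetaEstLaw, lintegral_map hmeas (measurable_thetaEst_rankPrefix N),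
      ← lintegral_comp_rankPrefix_ofReal P fun i => Finset.prod_nonneg fun j _ =>
        lowWt_nonneg (RankPrefix.thetaEst_nonneg i) j (c j)]
    refine lintegral_congr fun ω => ?_
    rw [ENNReal.ofReal_prod_of_nonneg fun j _ =>
      lowWt_nonneg (RankPrefix.thetaEst_nonneg _) j (c j)]
    exact Finset.prod_congr rfl fun j _ =>
      ewensLowWt_ofReal (RankPrefix.thetaEst_nonneg _) j (c j)
  have hcyl : ∀ N, n ≤ N → P.real (rankCyl (rankPrefix n c)) = ∑ i : RankPrefix N,
      P.real (rankCyl i) * (if ∀ j : Fin N, j.val < n → i j = c j then 1 else 0) := by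
    intro N hN
    have h := lintegral_comp_rankPrefix_ofReal P (N := N)
      (F := fun i => if ∀ j : Fin N, j.val < n → i j = c j then 1 else 0)
      (fun i => by split_ifs <;> norm_num)
    have hmeas : MeasurableSet (rankCyl (rankPrefix n c)) := by
      rw [← rankPrefix_preimage_singleton]
      exact measurable_rankPrefix n (measurableSet_singleton _)
    have h' : ∫⁻ ω, ENNReal.ofReal (if ∀ j : Fin N, j.val < n → rankPrefix N ω j = c j
        then 1 else 0) ∂P = P (rankCyl (rankPrefix n c)) := by
      rw [← lintegral_indicator_one hmeas]
      refine lintegral_congr fun ω => ?_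
      have : (∀ j : Fin N, j.val < n → rankPrefix N ω j = c j) ↔
          ω ∈ rankCyl (rankPrefix n c) :=
        ⟨fun H j => H ⟨j.val, by omega⟩ j.isLt, fun H j hj => H ⟨j.val, hj⟩⟩
      by_cases hω : ω ∈ rankCyl (rankPrefix n c) <;> simp [this, hω]
    rw [h'] at h
    rw [measureReal_def, h, ENNReal.toReal_ofReal]
    exact Finset.sum_nonneg fun i _ => mul_nonneg measureReal_nonneg (by split_ifs <;> norm_num)
  have hsum : ∀ N, ∑ i : RankPrefix N, P.real (rankCyl i) = 1 := by
    intro N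
    have h := lintegral_comp_rankPrefix_ofReal P (N := N) (F := fun _ => 1) (fun _ => zero_le_one)
    simp only [mul_one, ENNReal.ofReal_one, lintegral_one, measure_univ] at h
    exact ENNReal.ofReal_eq_one.1 h.symm
  have hlim : Tendsto A atTop (𝓝 (P.real (rankCyl (rankPrefix n c)))) := by
    rw [Metric.tendsto_nhds]
    intro ε hε
    obtain ⟨M, hM⟩ := exists_nat_gt (max 1 ((n : ℝ) * n * 2 / ε))
    have hM0 : 0 < M := by
      have : (1 : ℝ) < M := (le_max_left _ _).trans_lt hM
      exact_mod_cast zero_lt_one.trans this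
    have hM0' : (0 : ℝ) < M := by exact_mod_cast hM0
    have hM2 : (n : ℝ) * n * (1 / M) < ε / 2 := by
      have := (le_max_right _ _).trans_lt hM
      rw [div_lt_iff₀ hε] at this
      rw [mul_one_div, div_lt_iff₀ hM0']
      linarith
    have hH : Tendsto (fun N => (n : ℝ) * n * ((2 * n + M) / harmonicSum N)) atTop (𝓝 0) := by
      have := (tendsto_harmonicSum.const_div_atTop (2 * (n : ℝ) + M)).const_mul ((n : ℝ) * n)
      simpa using this
    filter_upwards [eventually_ge_atTop n, tendsto_harmonicSum.eventually_gt_atTop 0,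
      hH.eventually_lt_const (half_pos hε)] with N hN hH0 hHε
    rw [Real.dist_eq, abs_sub_comm, hcyl N hN]
    refine (RankPrefix.abs_sum_cylinder_sub_le hM0 hH0 hN (fun i => measureReal_nonneg) (hsum N)
      (fun i i' h => ?_) c).trans_lt ?_
    · rw [measureReal_def, measureReal_def, hP N i i' h]
    · nlinarith
  simp_rw [hint]
  rw [← ofReal_measureReal (μ := P)]
  exact (ENNReal.continuous_ofReal.tendsto _).comp hlim

theorem exists_ewens_mixture (P : Measure RankSpace) [IsProbabilityMeasure P]
    (hP : ∀ (n : ℕ) (i i' : RankPrefix n), lowerRecords i = lowerRecords i' →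
      P (rankCyl i) = P (rankCyl i')) :
    ∃ ν : Measure ℝ≥0∞, IsProbabilityMeasure ν ∧ ∀ (n : ℕ) (c : RankSpace),
      P (rankCyl (rankPrefix n c)) = ∫⁻ θ, ∏ j ∈ Finset.range n, ewensLowWt θ j (c j) ∂ν := by
  let law : ℕ → ProbabilityMeasure ℝ≥0∞ := fun N => ⟨thetaEstLaw P N, inferInstance⟩
  let U : Ultrafilter (ProbabilityMeasure ℝ≥0∞) := (hyperfilter ℕ).map law
  have hU : Tendsto law (hyperfilter ℕ) (𝓝 U.lim) := U.le_nhds_lim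
  refine ⟨U.lim, inferInstance, fun n c => ?_⟩
  let F : ℝ≥0∞ → NNReal := fun θ => ∏ j ∈ Finset.range n, (ewensLowWt θ j (c j)).toNNReal
  have hne : ∀ θ j (v : Fin (j + 1)), ewensLowWt θ j v ≠ ⊤ := fun θ j v =>
    ((ewensLowWt_le_one θ j v).trans_lt ENNReal.one_lt_top).ne
  have hF : Continuous F := continuous_finsetProd _ fun j _ =>
    continuous_iff_continuousAt.2 fun θ => (ENNReal.tendsto_toNNReal (hne θ j (c j))).comp
      (continuous_ewensLowWt j (c j)).continuousAt
  have hcoe : ∀ θ, ((F θ : NNReal) : ℝ≥0∞) = ∏ j ∈ Finset.range n, ewensLowWt θ j (c j) := by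
    intro θ
    simp only [F]
    push_cast
    exact Finset.prod_congr rfl fun j _ => ENNReal.coe_toNNReal (hne θ j (c j))
  have h1 := ProbabilityMeasure.tendsto_iff_forall_lintegral_tendsto.1 hU
    (BoundedContinuousFunction.mkOfCompact ⟨F, hF⟩)
  simp only [BoundedContinuousFunction.mkOfCompact_apply, ContinuousMap.coe_mk, hcoe] at h1
  exact tendsto_nhds_unique
    ((tendsto_lintegral_thetaEstLaw P hP n c).mono_left Nat.hyperfilter_le_atTop) h1

/-- The continuous extension of `θ ↦ 2 ^ (-θ)` to `[0, ∞]`. -/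
noncomputable def twoPowNeg (θ : ℝ≥0∞) : ℝ≥0∞ :=
  (EReal.exp ((ENNReal.ofReal (Real.log 2) * θ : ℝ≥0∞) : EReal))⁻¹

theorem continuous_twoPowNeg : Continuous twoPowNeg :=
  (ENNReal.continuous_exp.comp (continuous_coe_ennreal_ereal.comp
    (ENNReal.continuous_const_mul ENNReal.ofReal_ne_top))).inv

theorem twoPowNeg_injective : Function.Injective twoPowNeg := by
  intro x y h
  have hlog : ENNReal.ofReal (Real.log 2) ≠ 0 := by simpa using Real.log_pos one_lt_two
  have h' := EReal.exp_strictMono.injective (inv_injective h)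
  exact (ENNReal.mul_right_inj hlog ENNReal.ofReal_ne_top).1 (EReal.coe_ennreal_injective h')

theorem twoPowNeg_le_one (θ : ℝ≥0∞) : twoPowNeg θ ≤ 1 := by
  rw [twoPowNeg, ENNReal.inv_le_one, EReal.one_le_exp_iff]
  exact EReal.coe_ennreal_nonneg _

theorem twoPowNeg_top : twoPowNeg ⊤ = 0 := by
  have hlog : ENNReal.ofReal (Real.log 2) ≠ 0 := by simpa using Real.log_pos one_lt_two
  simp [twoPowNeg, ENNReal.mul_top hlog]

theorem twoPowNeg_ofReal {t : ℝ} (ht : 0 ≤ t) :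
    twoPowNeg (ENNReal.ofReal t) = ENNReal.ofReal (2 ^ (-t)) := by
  have hlog : 0 ≤ Real.log 2 := Real.log_nonneg one_le_two
  rw [twoPowNeg, ← ENNReal.ofReal_mul hlog, EReal.coe_ennreal_ofReal,
    max_eq_left (mul_nonneg hlog ht), EReal.exp_coe, ← ENNReal.ofReal_inv_of_pos (Real.exp_pos _),
    Real.rpow_neg zero_le_two, Real.rpow_def_of_pos zero_lt_two]

theorem prod_Ico_div_add_eq {t : ℝ} (ht : 0 < t) {n : ℕ} (hn : 0 < n) :
    ∏ j ∈ Finset.Ico 1 (n + 1), ((j : ℝ) / (t + j)) = t * (n : ℝ) ^ (-t) * Real.GammaSeq t n := by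
  have hn' : (0 : ℝ) < n := by exact_mod_cast hn
  have h1 : ∏ j ∈ Finset.Ico 1 (n + 1), (j : ℝ) = (n.factorial : ℝ) := by
    rw [← Nat.cast_prod, Finset.prod_Ico_id_eq_factorial]
  have h2 : ∏ j ∈ Finset.range (n + 1), (t + (j : ℝ))
      = t * ∏ j ∈ Finset.Ico 1 (n + 1), (t + (j : ℝ)) := by
    rw [Finset.range_eq_Ico, Finset.prod_eq_prod_Ico_succ_bot (Nat.succ_pos n)]
    simp
  have h3 : ∏ j ∈ Finset.Ico 1 (n + 1), (t + (j : ℝ)) ≠ 0 :=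
    Finset.prod_ne_zero_iff.2 fun j _ => by positivity
  have h4 : (n : ℝ) ^ t ≠ 0 := (Real.rpow_pos_of_pos hn' t).ne'
  rw [Finset.prod_div_distrib, h1, Real.GammaSeq, h2, Real.rpow_neg hn'.le]
  field_simp

theorem tendsto_prod_Ico_div_add {t : ℝ} (ht : 0 ≤ t) {m : ℕ} (hm : 0 < m) :
    Tendsto (fun N : ℕ => ∏ j ∈ Finset.Ico (N + 1) (m * N + 1), ((j : ℝ) / (t + j))) atTop
      (𝓝 ((m : ℝ) ^ (-t))) := by
  have hm' : (0 : ℝ) < m := by exact_mod_cast hm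
  rcases ht.eq_or_lt with rfl | ht
  · simp only [neg_zero, Real.rpow_zero, zero_add]
    refine tendsto_const_nhds.congr fun N => (Finset.prod_eq_one fun j hj => ?_).symm
    have : 0 < j := by have := (Finset.mem_Ico.1 hj).1; omega
    exact div_self (by positivity)
  have hΓ : Real.Gamma t ≠ 0 := (Real.Gamma_pos_of_pos ht).ne'
  have hG := Real.GammaSeq_tendsto_Gamma t
  have hG' : Tendsto (fun N : ℕ => Real.GammaSeq t (m * N)) atTop (𝓝 (Real.Gamma t)) :=
    hG.comp (tendsto_id.const_mul_atTop' hm)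
  have hlim := (hG'.div hG hΓ).const_mul ((m : ℝ) ^ (-t))
  rw [div_self hΓ, mul_one] at hlim
  refine hlim.congr' ?_
  filter_upwards [eventually_gt_atTop 0] with N hN
  have hN' : (0 : ℝ) < N := by exact_mod_cast hN
  have hle : N ≤ m * N := Nat.le_mul_of_pos_left N hm
  have hsplit := Finset.prod_Ico_consecutive (fun j : ℕ => (j : ℝ) / (t + j))
    (show 1 ≤ N + 1 by omega) (show N + 1 ≤ m * N + 1 by omega)
  rw [prod_Ico_div_add_eq ht hN, prod_Ico_div_add_eq ht (Nat.mul_pos hm hN)] at hsplit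
  have hpos : 0 < t * (N : ℝ) ^ (-t) * Real.GammaSeq t N := by
    rw [← prod_Ico_div_add_eq ht hN]
    refine Finset.prod_pos fun j hj => ?_
    have : 0 < j := (Finset.mem_Ico.1 hj).1
    positivity
  push_cast at hsplit
  rw [Real.mul_rpow hm'.le hN'.le] at hsplit
  have hGN : Real.GammaSeq t N ≠ 0 := right_ne_zero_of_mul hpos.ne'
  have hNt : (N : ℝ) ^ (-t) ≠ 0 := (Real.rpow_pos_of_pos hN' _).ne'
  simp only [Pi.div_apply]
  rw [eq_comm, ← mul_right_inj' hpos.ne', hsplit]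
  field_simp

/-- The `Q^θ`-probability that the coordinate of index `j` is not a lower record. -/
noncomputable def noRecordWt (θ : ℝ≥0∞) (j : ℕ) : ℝ≥0∞ :=
  ∑ v ∈ Finset.univ.erase (0 : Fin (j + 1)), ewensLowWt θ j v

theorem noRecordWt_le_one (θ : ℝ≥0∞) (j : ℕ) : noRecordWt θ j ≤ 1 := by
  rw [← sum_ewensLowWt θ j]
  exact Finset.sum_le_sum_of_subset (Finset.erase_subset _ _)

theorem measurable_noRecordWt (j : ℕ) : Measurable fun θ => noRecordWt θ j :=
  Finset.measurable_sum _ fun v _ => (continuous_ewensLowWt j v).measurable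

theorem noRecordWt_top {j : ℕ} (hj : 0 < j) : noRecordWt ⊤ j = 0 := by
  refine Finset.sum_eq_zero fun v hv => ?_
  have : v.val ≠ 0 := fun h => Finset.ne_of_mem_erase hv (Fin.ext h)
  simp [ewensLowWt, hj.ne', this]

theorem noRecordWt_ofReal {t : ℝ} (ht : 0 ≤ t) {j : ℕ} (hj : 0 < j) :
    noRecordWt (ENNReal.ofReal t) j = ENNReal.ofReal (j / (t + j)) := by
  have h : ∀ v ∈ Finset.univ.erase (0 : Fin (j + 1)),
      ewensLowWt (ENNReal.ofReal t) j v = ENNReal.ofReal (1 / (t + j)) := by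
    intro v hv
    have : v.val ≠ 0 := fun h => Finset.ne_of_mem_erase hv (Fin.ext h)
    rw [ewensLowWt_ofReal ht, lowWt, if_neg hj.ne', if_neg this]
  rw [noRecordWt, Finset.sum_congr rfl h, Finset.sum_const,
    Finset.card_erase_of_mem (Finset.mem_univ _), Finset.card_univ, Fintype.card_fin,
    Nat.add_sub_cancel, nsmul_eq_mul, ← ENNReal.ofReal_natCast,
    ← ENNReal.ofReal_mul (Nat.cast_nonneg j), mul_one_div]

theorem tendsto_prod_noRecordWt (θ : ℝ≥0∞) (k : ℕ) :
    Tendsto (fun N : ℕ => ∏ j ∈ Finset.Ico (N + 1) (2 ^ k * N + 1), noRecordWt θ j) atTop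
      (𝓝 (twoPowNeg θ ^ k)) := by
  by_cases hθ : θ = ⊤
  · subst hθ
    rcases Nat.eq_zero_or_pos k with rfl | hk
    · simp
    · rw [twoPowNeg_top, zero_pow hk.ne']
      refine tendsto_const_nhds.congr' ?_
      filter_upwards [eventually_gt_atTop 0] with N hN
      have h2 : 2 ≤ 2 ^ k := by simpa using Nat.pow_le_pow_right two_pos hk
      have hmem : N + 1 ∈ Finset.Ico (N + 1) (2 ^ k * N + 1) := by
        rw [Finset.mem_Ico]
        exact ⟨le_rfl, by nlinarith⟩
      exact (Finset.prod_eq_zero hmem (noRecordWt_top N.succ_pos)).symm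
  · obtain ⟨t, ht, rfl⟩ : ∃ t : ℝ, 0 ≤ t ∧ θ = ENNReal.ofReal t :=
      ⟨θ.toReal, ENNReal.toReal_nonneg, (ENNReal.ofReal_toReal hθ).symm⟩
    have h := (ENNReal.continuous_ofReal.tendsto _).comp
      (tendsto_prod_Ico_div_add ht (m := 2 ^ k) (by positivity))
    have hval : ENNReal.ofReal (((2 ^ k : ℕ) : ℝ) ^ (-t)) = twoPowNeg (ENNReal.ofReal t) ^ k := by
      rw [twoPowNeg_ofReal ht, ← ENNReal.ofReal_pow (by positivity)]
      congr 1
      push_cast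
      rw [← Real.rpow_natCast, ← Real.rpow_natCast, ← Real.rpow_mul zero_le_two,
        ← Real.rpow_mul zero_le_two, mul_comm]
    rw [hval] at h
    refine h.congr fun N => ?_
    simp only [Function.comp_apply]
    rw [ENNReal.ofReal_prod_of_nonneg fun j _ => by positivity]
    refine Finset.prod_congr rfl fun j hj => (noRecordWt_ofReal ht ?_).symm
    have := (Finset.mem_Ico.1 hj).1
    omega

/-- Under `Q^θ`, the absence of lower records in a window is a finite union of cylinders. -/
theorem sum_prod_ewensLowWt_eq_prod_noRecordWt (θ : ℝ≥0∞) (a b : ℕ) :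
    ∑ i ∈ Fintype.piFinset (fun j : Fin b =>
        if a ≤ j.val then Finset.univ.erase (0 : Fin (j.val + 1)) else Finset.univ),
      ∏ j : Fin b, ewensLowWt θ j.val (i j) = ∏ j ∈ Finset.Ico a b, noRecordWt θ j := by
  rw [← Finset.prod_univ_sum]
  have h : ∀ j : Fin b, ∑ v ∈ (if a ≤ j.val then Finset.univ.erase (0 : Fin (j.val + 1))
      else Finset.univ), ewensLowWt θ j.val v
      = (fun j : ℕ => if a ≤ j then noRecordWt θ j else 1) j.val := by
    intro j
    by_cases hj : a ≤ j.val
    · simp [hj, noRecordWt]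
    · simp [hj, sum_ewensLowWt]
  simp_rw [h]
  rw [Fin.prod_univ_eq_prod_range (fun j : ℕ => if a ≤ j then noRecordWt θ j else 1) b,
    ← Finset.prod_filter]
  refine Finset.prod_congr ?_ fun _ _ => rfl
  ext j
  simp [and_comm]

theorem measurable_prod_ewensLowWt {n : ℕ} (i : RankPrefix n) :
    Measurable fun θ => ∏ j : Fin n, ewensLowWt θ j.val (i j) :=
  Finset.measurable_prod _ fun j _ => (continuous_ewensLowWt j.val (i j)).measurable

theorem lintegral_twoPowNeg_pow_eq {μ ν : Measure ℝ≥0∞} [IsProbabilityMeasure μ]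
    [IsProbabilityMeasure ν]
    (h : ∀ (n : ℕ) (i : RankPrefix n), ∫⁻ θ, ∏ j : Fin n, ewensLowWt θ j.val (i j) ∂μ
      = ∫⁻ θ, ∏ j : Fin n, ewensLowWt θ j.val (i j) ∂ν) (k : ℕ) :
    ∫⁻ θ, twoPowNeg θ ^ k ∂μ = ∫⁻ θ, twoPowNeg θ ^ k ∂ν := by
  have hlim : ∀ (ρ : Measure ℝ≥0∞) [IsProbabilityMeasure ρ],
      Tendsto (fun N : ℕ => ∫⁻ θ, ∏ j ∈ Finset.Ico (N + 1) (2 ^ k * N + 1), noRecordWt θ j ∂ρ)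
        atTop (𝓝 (∫⁻ θ, twoPowNeg θ ^ k ∂ρ)) := by
    intro ρ _
    refine tendsto_lintegral_of_dominated_convergence (fun _ => 1)
      (fun N => Finset.measurable_prod _ fun j _ => measurable_noRecordWt j)
      (fun N => ae_of_all _ fun θ => Finset.prod_le_one' fun j _ => noRecordWt_le_one θ j)
      (by simp) (ae_of_all _ fun θ => tendsto_prod_noRecordWt θ k)
  have heq : ∀ a b : ℕ, ∫⁻ θ, ∏ j ∈ Finset.Ico a b, noRecordWt θ j ∂μ
      = ∫⁻ θ, ∏ j ∈ Finset.Ico a b, noRecordWt θ j ∂ν := by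
    intro a b
    simp_rw [← sum_prod_ewensLowWt_eq_prod_noRecordWt]
    rw [lintegral_finsetSum _ fun i _ => measurable_prod_ewensLowWt i,
      lintegral_finsetSum _ fun i _ => measurable_prod_ewensLowWt i]
    exact Finset.sum_congr rfl fun i _ => h b i
  exact tendsto_nhds_unique (hlim μ) ((hlim ν).congr fun N => (heq _ _).symm)

theorem measure_ext_of_lintegral_twoPowNeg_pow {μ ν : Measure ℝ≥0∞} [IsProbabilityMeasure μ]
    [IsProbabilityMeasure ν]
    (h : ∀ k : ℕ, ∫⁻ θ, twoPowNeg θ ^ k ∂μ = ∫⁻ θ, twoPowNeg θ ^ k ∂ν) : μ = ν := by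
  have hne : ∀ θ, twoPowNeg θ ≠ ⊤ := fun θ =>
    ((twoPowNeg_le_one θ).trans_lt ENNReal.one_lt_top).ne
  have hcont : Continuous fun θ => (twoPowNeg θ).toReal :=
    continuous_iff_continuousAt.2 fun θ => (ENNReal.tendsto_toReal (hne θ)).comp
      continuous_twoPowNeg.continuousAt
  let g : BoundedContinuousFunction ℝ≥0∞ ℝ := BoundedContinuousFunction.mkOfCompact ⟨_, hcont⟩
  have hg : ∀ θ, g θ = (twoPowNeg θ).toReal := fun _ => rfl
  have hpow : ∀ k : ℕ, ∫ θ, (g ^ k) θ ∂μ = ∫ θ, (g ^ k) θ ∂ν := by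
    intro k
    have hint : ∀ (ρ : Measure ℝ≥0∞) [IsProbabilityMeasure ρ],
        ∫ θ, (g ^ k) θ ∂ρ = (∫⁻ θ, twoPowNeg θ ^ k ∂ρ).toReal := by
      intro ρ _
      rw [← integral_toReal (continuous_twoPowNeg.measurable.pow_const k).aemeasurable
        (ae_of_all _ fun θ => ENNReal.pow_lt_top (hne θ).lt_top)]
      simp [hg]
    rw [hint μ, hint ν, h]
  have hpoly : ∀ p : Polynomial ℝ,
      ∫ θ, (Polynomial.aeval g p) θ ∂μ = ∫ θ, (Polynomial.aeval g p) θ ∂ν := by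
    intro p
    induction p using Polynomial.induction_on' with
    | add p q hp hq =>
      simp only [map_add, BoundedContinuousFunction.coe_add, Pi.add_apply]
      rw [integral_add (BoundedContinuousFunction.integrable μ _)
          (BoundedContinuousFunction.integrable μ _),
        integral_add (BoundedContinuousFunction.integrable ν _)
          (BoundedContinuousFunction.integrable ν _), hp, hq]
    | monomial k r =>
      have : ∀ θ, (Polynomial.aeval g (Polynomial.monomial k r)) θ = r * (g ^ k) θ := by
        intro θ
        rw [Polynomial.aeval_monomial, ← Algebra.smul_def, BoundedContinuousFunction.coe_smul]
        rfl
      simp_rw [this]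
      rw [integral_const_mul, integral_const_mul, hpow]
  refine ext_of_forall_mem_subalgebra_integral_eq_of_polish
    (A := StarAlgebra.adjoin ℝ {g}) ?_ fun f hf => ?_
  · intro x y hxy
    refine ⟨g, ⟨g.toContinuousMap, ⟨g, StarAlgebra.self_mem_adjoin_singleton ℝ g, rfl⟩, rfl⟩, ?_⟩
    rw [hg, hg]
    exact fun hne' => hxy (twoPowNeg_injective
      ((ENNReal.toReal_eq_toReal_iff' (hne x) (hne y)).1 hne'))
  · obtain ⟨p, rfl⟩ : ∃ p : Polynomial ℝ, f = Polynomial.aeval g p := by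
      induction hf using StarAlgebra.adjoin_induction with
      | mem x hx =>
        rw [Set.mem_singleton_iff.1 hx]
        exact ⟨Polynomial.X, by simp⟩
      | algebraMap r => exact ⟨Polynomial.C r, by simp⟩
      | add x y _ _ hx hy =>
        obtain ⟨p, rfl⟩ := hx
        obtain ⟨q, rfl⟩ := hy
        exact ⟨p + q, by simp⟩
      | mul x y _ _ hx hy =>
        obtain ⟨p, rfl⟩ := hx
        obtain ⟨q, rfl⟩ := hy
        exact ⟨p * q, by simp⟩
      | star x _ hx =>
        obtain ⟨p, rfl⟩ := hx
        exact ⟨p, by ext; simp⟩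
    exact hpoly p

/-- if each cylinder probability depends only on the number of lower
records `#{2 ≤ j ≤ n : i_j = 1}`, then `P` is a unique mixture of the Ewens laws `Q^θ`,
`θ ∈ [0,∞]`. -/
theorem stmt_12 (P : Measure RankSpace) [IsProbabilityMeasure P]
    (hP : ∀ (n : ℕ) (i i' : (j : Fin n) → Fin (j.val + 1)),
      (Finset.univ.filter fun j : Fin n => 1 ≤ j.val ∧ (i j).val = 0).card
        = (Finset.univ.filter fun j : Fin n => 1 ≤ j.val ∧ (i' j).val = 0).card →
      P (rankCyl i) = P (rankCyl i')) :
    ∃! ν : Measure ℝ≥0∞, IsProbabilityMeasure ν ∧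
      ∀ (n : ℕ) (i : (j : Fin n) → Fin (j.val + 1)),
        P (rankCyl i) = ∫⁻ θ, ∏ j : Fin n, ewensLowWt θ j.val (i j) ∂ν := by
  obtain ⟨ν, hν, hmix⟩ := exists_ewens_mixture P hP
  have hν' : ∀ (n : ℕ) (i : RankPrefix n),
      P (rankCyl i) = ∫⁻ θ, ∏ j : Fin n, ewensLowWt θ j.val (i j) ∂ν := by
    intro n i
    let c : RankSpace := fun k => if h : k < n then i ⟨k, h⟩ else 0
    have hc : ∀ j : Fin n, c j.val = i j := fun j => by simp [c]
    have h := hmix n c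
    rw [show rankPrefix n c = i from funext hc] at h
    rw [h]
    refine lintegral_congr fun θ => ?_
    rw [← Fin.prod_univ_eq_prod_range (fun j => ewensLowWt θ j (c j)) n]
    exact Finset.prod_congr rfl fun j _ => by rw [hc]
  refine ⟨ν, ⟨hν, hν'⟩, ?_⟩
  rintro μ ⟨hμ, hμ'⟩
  exact measure_ext_of_lintegral_twoPowNeg_pow
    (lintegral_twoPowNeg_pow_eq fun n i => (hμ' n i).symm.trans (hν' n i))
end

section
/- Let P be a probability measure on Ω = ∏_{n≥1} {1,…,n} such that for every n the cylinder probability P(ω_1 = i_1, …, ω_n = i_n) depends on (i_1,…,i_n) only through #{2 ≤ j ≤ n : i_j = j} (equivalently, each random permutation π_n is conditionally uniform given its number of upper records). For ζ ∈ [0,∞) let Q^ζ be the probability measure on Ω under which the coordinates are independent, ω_1 = 1, and for n ≥ 2: Q^ζ(ω_n = n) = ζ/(ζ+n−1) and Q^ζ(ω_n = r) = 1/(ζ+n−1) for 1 ≤ r ≤ n−1; let Q^∞ be the point mass at the sequence with ω_n = n for all n. Then there exists a unique probability measure ν on [0,∞] such that P(E) = ∫_{[0,∞]} Q^ζ(E)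 dν(ζ) for every cylinder event E. -/
open MeasureTheory ENNReal

/-- the `Q^ζ`-probability (`ζ ∈ [0,∞]`) that the coordinate of index `j` equals `v`:
for `j ≥ 1` (i.e. `n = j+1 ≥ 2`) it is `ζ/(ζ+j)` for the top rank `n` (i.e. `v = j`)
and `1/(ζ+j)` otherwise; `Q^∞` is the point mass on the all-upper-records sequence. -/
noncomputable def ewensUpWt (ζ : ℝ≥0∞) (j : ℕ) (v : Fin (j + 1)) : ℝ≥0∞ :=
  if j = 0 then 1
  else if ζ = ⊤ then (if v.val = j then 1 else 0)
  else if v.val = j then ζ / (ζ + (j : ℝ≥0∞))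
  else 1 / (ζ + (j : ℝ≥0∞))

open Filter Topology

/-- A nonnegative array satisfying the backward recursion of the Stirling triangle of the first
kind; `g k s` is the weight of a rank sequence with `k` upper records and `s` other ranks after
the first one. -/
structure IsRankFamily (g : ℕ → ℕ → ℝ) : Prop where
  nonneg : ∀ k s, 0 ≤ g k s
  coherent : ∀ k s, g k s = g (k + 1) s + (k + s + 1 : ℕ) * g k (s + 1)

/-- The operator on rank families which corresponds to multiplication by `1 / (ζ + 1)` of the
mixing measure. -/
noncomputable def rankResolvent (g : ℕ → ℕ → ℝ) (k s : ℕ) : ℝ :=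
  ∑' i, ((k + s).ascFactorial i : ℝ) * g k (s + i + 1)

namespace IsRankFamily

variable {g h : ℕ → ℕ → ℝ}

lemma ascFactorial_mul_le (hg : IsRankFamily g) (k s M : ℕ) :
    ((k + s + 1).ascFactorial M : ℝ) * g k (s + M) ≤ g k s := by
  induction M with
  | zero => simp
  | succ M ih =>
    refine le_trans ?_ ih
    rw [Nat.ascFactorial_succ, hg.coherent k (s + M)]
    have h0 : (0 : ℝ) ≤ (k + s + 1).ascFactorial M := by positivity
    have h1 := mul_nonneg h0 (hg.nonneg (k + 1) (s + M))
    push_cast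
    rw [← add_assoc s M 1]
    nlinarith

lemma sum_range_telescope (hg : IsRankFamily g) (k s M : ℕ) :
    ∑ i ∈ Finset.range M, ((k + s).ascFactorial i : ℝ) * (g k (s + i + 1) + g (k + 1) (s + i))
      = g k s - ((k + s).ascFactorial M : ℝ) * g k (s + M) := by
  induction M with
  | zero => simp
  | succ M ih =>
    rw [Finset.sum_range_succ, ih, Nat.ascFactorial_succ, hg.coherent k (s + M)]
    push_cast
    rw [← add_assoc s M 1]
    ring

lemma tendsto_ascFactorial_mul (hg : IsRankFamily g) (k s : ℕ) :
    Tendsto (fun M => ((k + s).ascFactorial M : ℝ) * g k (s + M)) atTop (𝓝 0) := by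
  have hlim : Tendsto (fun M : ℕ => ((k + s : ℕ) * g k s) / (M : ℝ)) atTop (𝓝 0) :=
    tendsto_const_div_atTop_nhds_zero_nat _
  refine tendsto_of_tendsto_of_tendsto_of_le_of_le' tendsto_const_nhds hlim
    (Eventually.of_forall fun M => mul_nonneg (by positivity) (hg.nonneg _ _)) ?_
  filter_upwards [eventually_gt_atTop 0] with M hM
  have hM' : (0 : ℝ) < M := by exact_mod_cast hM
  rw [le_div_iff₀ hM']
  have h1 := hg.ascFactorial_mul_le k s M
  have h2 : ((k + s : ℕ) : ℝ) * (k + s + 1).ascFactorial M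
      = (k + s + M : ℕ) * (k + s).ascFactorial M := by
    exact_mod_cast Nat.succ_ascFactorial (k + s) M
  have h3 := mul_le_mul_of_nonneg_left h1 (Nat.cast_nonneg (α := ℝ) (k + s))
  have h4 : (0 : ℝ) ≤ (k + s).ascFactorial M * g k (s + M) :=
    mul_nonneg (by positivity) (hg.nonneg _ _)
  have h5 : (M : ℝ) ≤ (k + s + M : ℕ) := by exact_mod_cast Nat.le_add_left _ _
  calc (k + s).ascFactorial M * g k (s + M) * M
      ≤ (k + s).ascFactorial M * g k (s + M) * (k + s + M : ℕ) := by gcongr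
    _ = (k + s : ℕ) * ((k + s + 1).ascFactorial M * g k (s + M)) := by
        rw [← mul_assoc, h2]; ring
    _ ≤ _ := h3

lemma hasSum_telescope (hg : IsRankFamily g) (k s : ℕ) :
    HasSum (fun i => ((k + s).ascFactorial i : ℝ) * (g k (s + i + 1) + g (k + 1) (s + i)))
      (g k s) := by
  rw [hasSum_iff_tendsto_nat_of_nonneg fun i =>
    mul_nonneg (by positivity) (add_nonneg (hg.nonneg _ _) (hg.nonneg _ _))]
  simp_rw [hg.sum_range_telescope]
  simpa using (hg.tendsto_ascFactorial_mul k s).const_sub (g k s)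

lemma summable_resolvent (hg : IsRankFamily g) (k s : ℕ) :
    Summable fun i => ((k + s).ascFactorial i : ℝ) * g k (s + i + 1) :=
  (hg.hasSum_telescope k s).summable.of_nonneg_of_le
    (fun i => mul_nonneg (by positivity) (hg.nonneg _ _))
    fun i => mul_le_mul_of_nonneg_left (le_add_of_nonneg_right (hg.nonneg _ _)) (by positivity)

lemma summable_compl (hg : IsRankFamily g) (k s : ℕ) :
    Summable fun i => ((k + s).ascFactorial i : ℝ) * g (k + 1) (s + i) :=
  (hg.hasSum_telescope k s).summable.of_nonneg_of_le
    (fun i => mul_nonneg (by positivity) (hg.nonneg _ _))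
    fun i => mul_le_mul_of_nonneg_left (le_add_of_nonneg_left (hg.nonneg _ _)) (by positivity)

lemma resolvent_add_tsum (hg : IsRankFamily g) (k s : ℕ) :
    rankResolvent g k s + ∑' i, ((k + s).ascFactorial i : ℝ) * g (k + 1) (s + i) = g k s := by
  rw [rankResolvent, ← (hg.summable_resolvent k s).tsum_add (hg.summable_compl k s),
    ← (hg.hasSum_telescope k s).tsum_eq]
  simp_rw [mul_add]

lemma resolvent_le (hg : IsRankFamily g) (k s : ℕ) : rankResolvent g k s ≤ g k s := by
  rw [← hg.resolvent_add_tsum k s]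
  exact le_add_of_nonneg_right (tsum_nonneg fun i => mul_nonneg (by positivity) (hg.nonneg _ _))

lemma resolvent_eq (hg : IsRankFamily g) (k s : ℕ) :
    rankResolvent g k s = g k (s + 1) + (k + s : ℕ) * rankResolvent g k (s + 1) := by
  rw [rankResolvent, (hg.summable_resolvent k s).tsum_eq_zero_add, rankResolvent, ← tsum_mul_left]
  simp only [Nat.ascFactorial_zero, Nat.cast_one, one_mul, add_zero]
  congr 1
  refine tsum_congr fun i => ?_
  have h2 : ((k + s : ℕ) : ℝ) * (k + (s + 1)).ascFactorial i = (k + s).ascFactorial (i + 1) := by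
    rw [Nat.ascFactorial_succ]
    exact_mod_cast Nat.succ_ascFactorial (k + s) i
  rw [← h2, mul_assoc]
  congr 4
  omega

lemma resolvent_add (hg : IsRankFamily g) (k s : ℕ) :
    rankResolvent g (k + 1) s + rankResolvent g k (s + 1) = g k (s + 1) := by
  rw [← hg.resolvent_add_tsum k (s + 1), add_comm, rankResolvent, rankResolvent]
  congr 1
  refine tsum_congr fun i => ?_
  rw [add_right_comm k 1 s, add_right_comm s i 1, add_assoc k s 1]

lemma map_resolvent (hg : IsRankFamily g) : IsRankFamily (rankResolvent g) where
  nonneg k s := tsum_nonneg fun i => mul_nonneg (by positivity) (hg.nonneg _ _)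
  coherent k s := by
    rw [hg.resolvent_eq k s, ← hg.resolvent_add k s]
    push_cast
    ring

lemma sub_resolvent (hg : IsRankFamily g) : IsRankFamily (g - rankResolvent g) where
  nonneg k s := sub_nonneg.2 (hg.resolvent_le k s)
  coherent k s := by
    simp only [Pi.sub_apply]
    rw [hg.coherent k s, hg.map_resolvent.coherent k s]
    ring

lemma resolvent_sub (hg : IsRankFamily g) (hh : IsRankFamily h) :
    rankResolvent (g - h) = rankResolvent g - rankResolvent h := by
  ext k s
  simp only [rankResolvent, Pi.sub_apply, mul_sub]
  exact (hg.summable_resolvent k s).tsum_sub (hh.summable_resolvent k s)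

lemma eq_of_resolvent_eq {p : ℕ → ℕ → ℝ} (hg : IsRankFamily g) (hh : IsRankFamily h)
    (hgp : ∀ k s, g k s = p k (s + 1) + (k + s : ℕ) * g k (s + 1))
    (hhp : ∀ k s, h k s = p k (s + 1) + (k + s : ℕ) * h k (s + 1)) : g = h := by
  ext k s
  have key : ∀ M, ((k + s).ascFactorial M : ℝ) * g k (s + M)
      - ((k + s).ascFactorial M : ℝ) * h k (s + M) = g k s - h k s := by
    intro M
    induction M with
    | zero => simp
    | succ M ih =>
      rw [← ih, hgp k (s + M), hhp k (s + M), Nat.ascFactorial_succ]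
      push_cast
      rw [← add_assoc s M 1]
      ring
  have hlim := (hg.tendsto_ascFactorial_mul k s).sub (hh.tendsto_ascFactorial_mul k s)
  simp_rw [key] at hlim
  have := tendsto_nhds_unique hlim tendsto_const_nhds
  linarith

end IsRankFamily

/-- A rank family `c 0 0` together with the families `c l r` obtained from it by multiplying the
mixing measure by `u ^ l * (1 - u) ^ r`, where `u = 1 / (ζ + 1)`. -/
structure IsRankTower (c : ℕ → ℕ → ℕ → ℕ → ℝ) : Prop where
  family : ∀ l r, IsRankFamily (c l r)
  split : ∀ l r k s, c l r k s = c (l + 1) r k s + c l (r + 1) k s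
  res : ∀ l r k s, c (l + 1) r k s = c l r k (s + 1) + (k + s : ℕ) * c (l + 1) r k (s + 1)

lemma IsRankFamily.exists_tower {g : ℕ → ℕ → ℝ} (hg : IsRankFamily g) :
    ∃ c, IsRankTower c ∧ c 0 0 = g := by
  let S : (ℕ → ℕ → ℝ) → ℕ → ℕ → ℝ := fun f => f - rankResolvent f
  have hT : ∀ l, IsRankFamily (rankResolvent^[l] g) := by
    intro l
    induction l with
    | zero => exact hg
    | succ l ih => rw [Function.iterate_succ_apply']; exact ih.map_resolvent
  have hS : ∀ r f, IsRankFamily f → IsRankFamily (S^[r] f) := by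
    intro r
    induction r with
    | zero => exact fun f hf => hf
    | succ r ih => intro f hf; rw [Function.iterate_succ_apply]; exact ih _ hf.sub_resolvent
  have hST : ∀ r f, IsRankFamily f → rankResolvent (S^[r] f) = S^[r] (rankResolvent f) := by
    intro r
    induction r with
    | zero => exact fun f hf => rfl
    | succ r ih =>
      intro f hf
      rw [Function.iterate_succ_apply, Function.iterate_succ_apply, ih _ hf.sub_resolvent]
      exact congrArg _ (hf.resolvent_sub hf.map_resolvent)
  refine ⟨fun l r => S^[r] (rankResolvent^[l] g), ⟨fun l r => hS r _ (hT l), ?_, ?_⟩, rfl⟩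
  · intro l r k s
    rw [Function.iterate_succ_apply', Function.iterate_succ_apply', ← hST r _ (hT l)]
    simp [S]
  · intro l r k s
    rw [Function.iterate_succ_apply', ← hST r _ (hT l)]
    exact (hS r _ (hT l)).resolvent_eq k s

namespace IsRankTower

variable {c c' : ℕ → ℕ → ℕ → ℕ → ℝ}

lemma le_zero_right (hc : IsRankTower c) (l r k s : ℕ) : c l r k s ≤ c l 0 k s := by
  induction r with
  | zero => exact le_rfl
  | succ r ih => linarith [hc.split l r k s, (hc.family (l + 1) r).nonneg k s]

lemma le_zero_zero (hc : IsRankTower c) (l r k s : ℕ) : c l r k s ≤ c 0 0 k s := by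
  refine (hc.le_zero_right l r k s).trans ?_
  induction l with
  | zero => exact le_rfl
  | succ l ih => linarith [hc.split l 0 k s, (hc.family l 1).nonneg k s]

lemma le_origin (hc : IsRankTower c) (l r k s : ℕ) : c l r k s ≤ c 0 0 0 0 := by
  refine (hc.le_zero_zero l r k s).trans ?_
  have hf := hc.family 0 0
  have hk : ∀ k s, c 0 0 (k + 1) s ≤ c 0 0 k s := fun k s => by
    have := mul_nonneg (Nat.cast_nonneg (α := ℝ) (k + s + 1)) (hf.nonneg k (s + 1))
    linarith [hf.coherent k s]
  have hs : ∀ k s, c 0 0 k (s + 1) ≤ c 0 0 k s := fun k s => by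
    have := mul_nonneg (Nat.cast_nonneg (α := ℝ) (k + s)) (hf.nonneg k (s + 1))
    have h2 := hf.coherent k s
    push_cast at h2 this
    nlinarith [hf.nonneg (k + 1) s]
  exact (antitone_nat_of_succ_le (f := fun k => c 0 0 k s) (fun k => hk k s) (Nat.zero_le k)).trans
    (antitone_nat_of_succ_le (f := fun s => c 0 0 0 s) (fun s => hs 0 s) (Nat.zero_le s))

lemma eq_of_zero_right (hc : IsRankTower c) (hc' : IsRankTower c') {k s : ℕ}
    (h : ∀ l, c l 0 k s = c' l 0 k s) (l r : ℕ) : c l r k s = c' l r k s := by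
  induction r generalizing l with
  | zero => exact h l
  | succ r ih => linarith [hc.split l r k s, hc'.split l r k s, ih l, ih (l + 1)]

lemma eq_of_family_eq (hc : IsRankTower c) (hc' : IsRankTower c') (h : c 0 0 = c' 0 0)
    (l : ℕ) : c l 0 = c' l 0 := by
  induction l with
  | zero => exact h
  | succ l ih =>
    refine (hc.family (l + 1) 0).eq_of_resolvent_eq (hc'.family (l + 1) 0) (hc.res l 0) ?_
    rw [ih]
    exact hc'.res l 0

lemma eq_of_moments_eq (hc : IsRankTower c) (hc' : IsRankTower c')
    (h : ∀ l, c l 0 0 0 = c' l 0 0 0) (l k s : ℕ) : c l 0 k s = c' l 0 k s := by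
  induction k generalizing s with
  | succ k ih =>
    have h1 := (hc.family l 0).coherent k s
    have h2 := (hc'.family l 0).coherent k s
    rw [ih s, ih (s + 1)] at h1
    linarith
  | zero =>
    induction s generalizing l with
    | zero => exact h l
    | succ s ih =>
      have heq := hc.eq_of_zero_right hc' ih
      have hstep : ∀ r, (s : ℝ) * (c l (r + 1) 0 (s + 1) - c' l (r + 1) 0 (s + 1))
          = (s + 1) * (c l r 0 (s + 1) - c' l r 0 (s + 1)) := by
        intro r
        have h1 := hc.res l r 0 s
        have h2 := hc'.res l r 0 s
        have h3 := hc.split l r 0 (s + 1)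
        have h4 := hc'.split l r 0 (s + 1)
        have h5 := heq (l + 1) r
        have h6 : c l (r + 1) 0 (s + 1) = c l r 0 (s + 1) - c (l + 1) r 0 (s + 1) := by linarith
        have h7 : c' l (r + 1) 0 (s + 1) = c' l r 0 (s + 1) - c' (l + 1) r 0 (s + 1) := by
          linarith
        rw [h6, h7]
        simp only [zero_add] at h1 h2
        linarith
      by_contra hne
      set d : ℝ := c l 0 0 (s + 1) - c' l 0 0 (s + 1) with hd
      have hd0 : d ≠ 0 := sub_ne_zero.2 hne
      have hs : (0 : ℝ) < s := by
        rcases Nat.eq_zero_or_pos s with rfl | hs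
        · have := hstep 0
          simp at this
          exact absurd this.symm hd0
        · exact_mod_cast hs
      have hpow : ∀ r, c l r 0 (s + 1) - c' l r 0 (s + 1) = ((s + 1) / s : ℝ) ^ r * d := by
        intro r
        induction r with
        | zero => simp [hd]
        | succ r ihr =>
          have := hstep r
          rw [ihr] at this
          rw [pow_succ]
          field_simp
          rw [mul_comm] at this
          field_simp at this
          linarith
      have hbound : ∀ r, ((s + 1) / s : ℝ) ^ r * |d| ≤ c 0 0 0 0 + c' 0 0 0 0 := by
        intro r
        rw [← abs_of_nonneg (show (0 : ℝ) ≤ ((s + 1) / s : ℝ) ^ r by positivity), ← abs_mul,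
          ← hpow r, abs_le]
        have h1 := (hc.family l r).nonneg 0 (s + 1)
        have h2 := (hc'.family l r).nonneg 0 (s + 1)
        have h3 := hc.le_origin l r 0 (s + 1)
        have h4 := hc'.le_origin l r 0 (s + 1)
        constructor <;> linarith
      have hgt : (1 : ℝ) < (s + 1) / s := by rw [lt_div_iff₀ hs]; linarith
      obtain ⟨r, hr⟩ := pow_unbounded_of_one_lt ((c 0 0 0 0 + c' 0 0 0 0) / |d|) hgt
      rw [div_lt_iff₀ (abs_pos.2 hd0)] at hr
      exact absurd (hbound r) (not_le.2 hr)

end IsRankTower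

lemma exists_pow_sub_descFactorial_le (l : ℕ) : ∃ C : ℝ, 0 ≤ C ∧ ∀ N i : ℕ, i ≤ N →
    (N : ℝ) * ((i : ℝ) ^ l - i.descFactorial l) ≤ C * (N : ℝ) ^ l := by
  induction l with
  | zero => exact ⟨0, le_rfl, fun N i _ => by simp⟩
  | succ l ih =>
    obtain ⟨C, hC, h⟩ := ih
    refine ⟨C + l, by positivity, fun N i hi => ?_⟩
    have hcast : (i.descFactorial (l + 1) : ℝ) = ((i : ℝ) - l) * i.descFactorial l := by
      rw [Nat.descFactorial_succ]
      rcases le_or_gt l i with hl | hl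
      · push_cast [Nat.cast_sub hl]; ring
      · simp [Nat.descFactorial_eq_zero_iff_lt.2 hl]
    have hi' : (i : ℝ) ≤ N := by exact_mod_cast hi
    have h1 : (i.descFactorial l : ℝ) ≤ (N : ℝ) ^ l := by
      exact_mod_cast (Nat.descFactorial_le_pow i l).trans (Nat.pow_le_pow_left hi l)
    have h2 : (0 : ℝ) ≤ (i : ℝ) ^ l - i.descFactorial l := by
      rw [sub_nonneg]; exact_mod_cast Nat.descFactorial_le_pow i l
    calc (N : ℝ) * ((i : ℝ) ^ (l + 1) - i.descFactorial (l + 1))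
        = i * (N * ((i : ℝ) ^ l - i.descFactorial l)) + N * (l * i.descFactorial l) := by
          rw [hcast]; ring
      _ ≤ N * (C * (N : ℝ) ^ l) + N * (l * (N : ℝ) ^ l) := by
          have := h N i hi
          gcongr
      _ = _ := by ring

section Hausdorff

variable {b : ℕ → ℕ → ℝ}

lemma sum_antidiagonal_choose_mul_shift (hb : ∀ l r, b l r = b (l + 1) r + b l (r + 1))
    (N a r : ℕ) :
    ∑ p ∈ Finset.HasAntidiagonal.antidiagonal N,
      (N.choose p.1 : ℝ) * b (a + p.1) (r + p.2) = b a r := by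
  induction N generalizing a r with
  | zero => simp
  | succ N ih =>
    rw [Finset.sum_antidiagonal_choose_succ_mul (fun i j => b (a + i) (r + j)), hb a r,
      ← ih (a + 1) r, ← ih a (r + 1), add_comm]
    congr 1
    · refine Finset.sum_congr rfl fun p hp => ?_
      rw [← Nat.choose_symm_of_eq_add (Finset.HasAntidiagonal.mem_antidiagonal.1 hp).symm]
      congr 2; omega
    · refine Finset.sum_congr rfl fun p _ => ?_
      congr 2; omega

lemma sum_antidiagonal_choose_mul_descFactorial (hb : ∀ l r, b l r = b (l + 1) r + b l (r + 1))
    (l N a : ℕ) :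
    ∑ p ∈ Finset.HasAntidiagonal.antidiagonal N,
      (N.choose p.1 : ℝ) * b (a + p.1) p.2 * p.1.descFactorial l
      = N.descFactorial l * b (a + l) 0 := by
  induction l generalizing N a with
  | zero => simpa using sum_antidiagonal_choose_mul_shift hb N a 0
  | succ l ih =>
    cases N with
    | zero => simp
    | succ N =>
      rw [Finset.Nat.sum_antidiagonal_succ]
      simp only [Nat.zero_descFactorial_succ, Nat.cast_zero, mul_zero, zero_add]
      have h := congrArg (fun x => ((N + 1 : ℕ) : ℝ) * x) (ih N (a + 1))
      simp only [Finset.mul_sum] at h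
      have e : ∀ p : ℕ × ℕ, (((N + 1).choose (p.1 + 1) : ℕ) : ℝ) * b (a + (p.1 + 1)) p.2
          * ((p.1 + 1).descFactorial (l + 1) : ℕ)
          = ((N + 1 : ℕ) : ℝ) * ((N.choose p.1 : ℝ) * b (a + 1 + p.1) p.2
            * p.1.descFactorial l) := by
        intro p
        have h1 : (((N + 1).choose (p.1 + 1) : ℕ) : ℝ) * ((p.1 + 1 : ℕ) : ℝ)
            = ((N + 1 : ℕ) : ℝ) * (N.choose p.1 : ℕ) := by
          exact_mod_cast (Nat.add_one_mul_choose_eq N p.1).symm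
        rw [Nat.succ_descFactorial_succ, Nat.cast_mul, add_right_comm a 1 p.1, ← add_assoc]
        linear_combination (b (a + p.1 + 1) p.2 * p.1.descFactorial l) * h1
      simp_rw [e]
      rw [h, Nat.succ_descFactorial_succ, add_right_comm a 1 l, ← add_assoc]
      push_cast
      ring

/-- The moments of the empirical laws `∑ i, C(N, i) b i (N - i) δ_{i / N}` converge to `b · 0`. -/
lemma tendsto_sum_antidiagonal_moment (h0 : ∀ l r, 0 ≤ b l r)
    (hb : ∀ l r, b l r = b (l + 1) r + b l (r + 1)) (l : ℕ) :
    Tendsto (fun N : ℕ => ∑ p ∈ Finset.HasAntidiagonal.antidiagonal N,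
      (N.choose p.1 : ℝ) * b p.1 p.2 * ((p.1 : ℝ) / N) ^ l) atTop (𝓝 (b l 0)) := by
  obtain ⟨C, hC, hCb⟩ := exists_pow_sub_descFactorial_le l
  have hmass := fun N => sum_antidiagonal_choose_mul_shift hb N 0 0
  have hdesc := fun N => sum_antidiagonal_choose_mul_descFactorial hb l N 0
  simp only [zero_add] at hmass hdesc
  have hbl : b l 0 ≤ b 0 0 :=
    antitone_nat_of_succ_le (f := fun l => b l 0)
      (fun l => by linarith [hb l 0, h0 l 1]) (Nat.zero_le l)
  have hlim : Tendsto (fun N : ℕ => C * b 0 0 / (N : ℝ)) atTop (𝓝 0) :=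
    tendsto_const_div_atTop_nhds_zero_nat _
  rw [tendsto_iff_norm_sub_tendsto_zero]
  refine tendsto_of_tendsto_of_tendsto_of_le_of_le' tendsto_const_nhds hlim
    (Eventually.of_forall fun N => norm_nonneg _) ?_
  filter_upwards [eventually_gt_atTop 0] with N hN
  have hN' : (0 : ℝ) < N := by exact_mod_cast hN
  have hNl : (0 : ℝ) < (N : ℝ) ^ l := by positivity
  set A : ℝ := ∑ p ∈ Finset.HasAntidiagonal.antidiagonal N,
    (N.choose p.1 : ℝ) * b p.1 p.2 * ((p.1 : ℝ) ^ l - p.1.descFactorial l) with hA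
  have hA0 : 0 ≤ A := Finset.sum_nonneg fun p _ => by
    have : (0 : ℝ) ≤ (p.1 : ℝ) ^ l - p.1.descFactorial l := by
      rw [sub_nonneg]; exact_mod_cast Nat.descFactorial_le_pow p.1 l
    have := h0 p.1 p.2
    positivity
  have hA1 : N * A ≤ C * (N : ℝ) ^ l * b 0 0 := by
    rw [hA, Finset.mul_sum, ← hmass N, Finset.mul_sum]
    refine Finset.sum_le_sum fun p hp => ?_
    have h1 := hCb N p.1 (by have := Finset.HasAntidiagonal.mem_antidiagonal.1 hp; omega)
    have h2 := mul_nonneg (Nat.cast_nonneg (α := ℝ) (N.choose p.1)) (h0 p.1 p.2)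
    have := mul_le_mul_of_nonneg_left h1 h2
    linarith
  have hD0 : (0 : ℝ) ≤ (N : ℝ) ^ l - N.descFactorial l := by
    rw [sub_nonneg]; exact_mod_cast Nat.descFactorial_le_pow N l
  have hD1 := hCb N N le_rfl
  have hsum : ∑ p ∈ Finset.HasAntidiagonal.antidiagonal N,
      (N.choose p.1 : ℝ) * b p.1 p.2 * ((p.1 : ℝ) / N) ^ l - b l 0
      = (A - ((N : ℝ) ^ l - N.descFactorial l) * b l 0) / (N : ℝ) ^ l := by
    have : A = ∑ p ∈ Finset.HasAntidiagonal.antidiagonal N,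
        (N.choose p.1 : ℝ) * b p.1 p.2 * (p.1 : ℝ) ^ l - N.descFactorial l * b l 0 := by
      simp only [hA, mul_sub, Finset.sum_sub_distrib, hdesc N]
    rw [this]
    simp_rw [div_pow, ← mul_div_assoc]
    rw [← Finset.sum_div]
    field_simp
    ring
  rw [hsum, Real.norm_eq_abs, abs_div, abs_of_pos hNl, div_le_div_iff₀ hNl hN']
  have h3 : N * (((N : ℝ) ^ l - N.descFactorial l) * b l 0) ≤ C * (N : ℝ) ^ l * b 0 0 := by
    rw [← mul_assoc]
    exact mul_le_mul hD1 hbl (h0 l 0) (by positivity)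
  have h4 := mul_nonneg hD0 (h0 l 0)
  have h5 := mul_nonneg hN'.le h4
  have h6 := mul_nonneg hN'.le hA0
  rw [← abs_of_pos hN', ← abs_mul, abs_le, abs_of_pos hN']
  constructor <;> nlinarith

end Hausdorff

/-- The homeomorphism `ζ ↦ 1 / (ζ + 1)` of `[0, ∞]` onto `[0, 1]`, as a bounded function. -/
noncomputable def recipSucc : BoundedContinuousFunction ℝ≥0∞ ℝ :=
  BoundedContinuousFunction.mkOfCompact ⟨fun ζ => ((ζ + 1)⁻¹).toReal, by
    rw [← continuousOn_univ]
    exact ENNReal.continuousOn_toReal.comp (by fun_prop) fun ζ _ => by simp⟩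

lemma recipSucc_apply (ζ : ℝ≥0∞) : recipSucc ζ = ((ζ + 1)⁻¹).toReal := rfl

lemma recipSucc_injective : Function.Injective recipSucc := by
  intro x y h
  rw [recipSucc_apply, recipSucc_apply, ENNReal.toReal_eq_toReal_iff' (by simp) (by simp),
    inv_inj] at h
  exact (ENNReal.add_left_inj ENNReal.one_ne_top).1 h

lemma recipSucc_inv_sub_one {x : ℝ≥0∞} (hx : x ≤ 1) : recipSucc (x⁻¹ - 1) = x.toReal := by
  rw [recipSucc_apply, tsub_add_cancel_of_le (ENNReal.one_le_inv.2 hx), inv_inv]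

/-- The Hausdorff moment problem, transported to `[0, ∞]`. -/
lemma exists_measure_moments {b : ℕ → ℕ → ℝ} (h0 : ∀ l r, 0 ≤ b l r) (h1 : b 0 0 = 1)
    (hb : ∀ l r, b l r = b (l + 1) r + b l (r + 1)) :
    ∃ ν : Measure ℝ≥0∞, IsProbabilityMeasure ν ∧ ∀ l, ∫ ζ, recipSucc ζ ^ l ∂ν = b l 0 := by
  let pt : ℕ → ℕ × ℕ → ℝ≥0∞ := fun N p => ((p.1 : ℝ≥0∞) / N)⁻¹ - 1
  let μ : ℕ → Measure ℝ≥0∞ := fun N => ∑ p ∈ Finset.HasAntidiagonal.antidiagonal N,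
    ENNReal.ofReal (N.choose p.1 * b p.1 p.2) • Measure.dirac (pt N p)
  have hμ : ∀ N, IsProbabilityMeasure (μ N) := by
    intro N
    constructor
    have hm := sum_antidiagonal_choose_mul_shift hb N 0 0
    simp only [zero_add, h1] at hm
    simp only [μ, Measure.coe_finsetSum, Finset.sum_apply, Measure.smul_apply, measure_univ,
      smul_eq_mul, mul_one]
    rw [← ENNReal.ofReal_sum_of_nonneg fun p _ => mul_nonneg (by positivity) (h0 _ _), hm,
      ENNReal.ofReal_one]
  have hint : ∀ N l, ∫ ζ, recipSucc ζ ^ l ∂(μ N) = ∑ p ∈ Finset.HasAntidiagonal.antidiagonal N,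
      (N.choose p.1 : ℝ) * b p.1 p.2 * ((p.1 : ℝ) / N) ^ l := by
    intro N l
    have hi : ∀ p ∈ Finset.HasAntidiagonal.antidiagonal N, Integrable (fun ζ => recipSucc ζ ^ l)
        (ENNReal.ofReal (N.choose p.1 * b p.1 p.2) • Measure.dirac (pt N p)) := fun p _ =>
      (integrable_dirac (by simp)).smul_measure ENNReal.ofReal_ne_top
    rw [integral_finsetSum_measure hi]
    refine Finset.sum_congr rfl fun p hp => ?_
    have hp1 : p.1 ≤ N := by have := Finset.HasAntidiagonal.mem_antidiagonal.1 hp; omega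
    have hx : (p.1 : ℝ≥0∞) / N ≤ 1 :=
      ENNReal.div_le_of_le_mul (by rw [one_mul]; exact_mod_cast hp1)
    rw [integral_smul_measure, integral_dirac, recipSucc_inv_sub_one hx,
      ENNReal.toReal_ofReal (mul_nonneg (by positivity) (h0 _ _))]
    simp
  let P : ℕ → ProbabilityMeasure ℝ≥0∞ := fun N => ⟨μ N, hμ N⟩
  let U : Ultrafilter (ProbabilityMeasure ℝ≥0∞) := (hyperfilter ℕ).map P
  have hU : Tendsto P (hyperfilter ℕ) (𝓝 U.lim) := U.le_nhds_lim
  refine ⟨U.lim, inferInstance, fun l => ?_⟩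
  have hl := ProbabilityMeasure.tendsto_iff_forall_integral_tendsto.1 hU (recipSucc ^ l)
  simp only [BoundedContinuousFunction.coe_pow, Pi.pow_apply] at hl
  refine tendsto_nhds_unique hl ?_
  refine ((tendsto_sum_antidiagonal_moment h0 hb l).mono_left Nat.hyperfilter_le_atTop).congr ?_
  exact fun N => (hint N l).symm

lemma measure_ext_of_moments {ν ν' : Measure ℝ≥0∞} [IsProbabilityMeasure ν]
    [IsProbabilityMeasure ν']
    (h : ∀ l : ℕ, ∫ ζ, recipSucc ζ ^ l ∂ν = ∫ ζ, recipSucc ζ ^ l ∂ν') : ν = ν' := by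
  let A : StarSubalgebra ℝ (BoundedContinuousFunction ℝ≥0∞ ℝ) :=
    { Algebra.adjoin ℝ {recipSucc} with
      star_mem' := fun {a} ha => by
        rwa [show star a = a from by ext x; simp] }
  have hA : ∀ g, g ∈ A ↔ g ∈ Algebra.adjoin ℝ {recipSucc} := fun g => Iff.rfl
  refine ext_of_forall_mem_subalgebra_integral_eq_of_polish (𝕜 := ℝ) (A := A) ?_ ?_
  · intro x y hxy
    refine ⟨recipSucc, ⟨BoundedContinuousFunction.toContinuousMapStarₐ ℝ recipSucc, ?_, rfl⟩,
      recipSucc_injective.ne hxy⟩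
    exact ⟨recipSucc, Algebra.subset_adjoin rfl, rfl⟩
  · intro g hg
    rw [hA, ← Subalgebra.mem_toSubmodule, Algebra.adjoin_eq_span] at hg
    induction hg using Submodule.span_induction with
    | mem x hx =>
      obtain ⟨l, rfl⟩ := Submonoid.mem_closure_singleton.1 hx
      simpa using h l
    | zero => simp
    | add x y _ _ hx hy =>
      simp only [BoundedContinuousFunction.coe_add, Pi.add_apply]
      rw [integral_add (x.integrable ν) (y.integrable ν),
        integral_add (x.integrable ν') (y.integrable ν'), hx, hy]
    | smul a x _ hx =>
      simp only [BoundedContinuousFunction.coe_smul, integral_smul, hx]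

/-- The weight that `Q^ζ` gives to a rank sequence with `k` upper records and `s` other ranks after
the first one, multiplied by `u ^ l * (1 - u) ^ r`, where `u = 1 / (ζ + 1)`. -/
noncomputable def ewensTower (ζ : ℝ≥0∞) (l r k s : ℕ) : ℝ :=
  if ζ = ⊤ then (if l = 0 ∧ s = 0 then 1 else 0)
  else ζ.toReal ^ (k + r) /
    ((ζ.toReal + 1) ^ (l + r) * ∏ j ∈ Finset.range (k + s), (ζ.toReal + (j + 1 : ℕ)))

lemma isRankTower_ewensTower (ζ : ℝ≥0∞) : IsRankTower (ewensTower ζ) := by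
  by_cases hζ : ζ = ⊤
  · subst hζ
    refine ⟨fun l r => ⟨fun k s => ?_, fun k s => ?_⟩, fun l r k s => ?_, fun l r k s => ?_⟩ <;>
      simp [ewensTower]
    split_ifs <;> norm_num
  · have hz : 0 ≤ ζ.toReal := ENNReal.toReal_nonneg
    have hj : ∀ j : ℕ, 0 < ζ.toReal + (j + 1 : ℕ) := fun j => by positivity
    have hp : ∀ n, 0 < ∏ j ∈ Finset.range n, (ζ.toReal + (j + 1 : ℕ)) := fun n =>
      Finset.prod_pos fun j _ => hj j
    have h1 : 0 < ζ.toReal + 1 := by positivity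
    refine ⟨fun l r => ⟨fun k s => ?_, fun k s => ?_⟩, fun l r k s => ?_, fun l r k s => ?_⟩ <;>
      simp only [ewensTower, if_neg hζ]
    · have := hp (k + s)
      positivity
    · rw [add_right_comm k 1 s, ← add_assoc k s 1, Finset.prod_range_succ]
      have h2 := hp (k + s)
      have h3 := hj (k + s)
      generalize ∏ j ∈ Finset.range (k + s), (ζ.toReal + (j + 1 : ℕ)) = p at *
      push_cast at *
      field_simp
      ring
    · have h2 := hp (k + s)
      generalize ∏ j ∈ Finset.range (k + s), (ζ.toReal + (j + 1 : ℕ)) = p at *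
      field_simp
      ring
    · rw [← add_assoc k s 1, Finset.prod_range_succ]
      have h2 := hp (k + s)
      have h3 := hj (k + s)
      generalize ∏ j ∈ Finset.range (k + s), (ζ.toReal + (j + 1 : ℕ)) = p at *
      push_cast at *
      field_simp
      ring

lemma ewensTower_origin (ζ : ℝ≥0∞) : ewensTower ζ 0 0 0 0 = 1 := by
  simp [ewensTower]

lemma ewensTower_moment (ζ : ℝ≥0∞) (l : ℕ) : ewensTower ζ l 0 0 0 = recipSucc ζ ^ l := by
  rw [recipSucc_apply]
  by_cases hζ : ζ = ⊤
  · simp [ewensTower, hζ, zero_pow_eq]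
  · simp [ewensTower, hζ, ENNReal.toReal_add hζ]

lemma measurable_ewensTower (l r k s : ℕ) : Measurable fun ζ => ewensTower ζ l r k s := by
  unfold ewensTower
  refine Measurable.ite (measurableSet_singleton _) measurable_const ?_
  have := ENNReal.measurable_toReal
  fun_prop

lemma integrable_ewensTower (ν : Measure ℝ≥0∞) [IsProbabilityMeasure ν] (l r k s : ℕ) :
    Integrable (fun ζ => ewensTower ζ l r k s) ν := by
  refine Integrable.of_bound (measurable_ewensTower l r k s).aestronglyMeasurable 1
    (Eventually.of_forall fun ζ => ?_)
  have h := isRankTower_ewensTower ζ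
  rw [Real.norm_of_nonneg ((h.family l r).nonneg k s), ← ewensTower_origin ζ]
  exact h.le_origin l r k s

lemma isRankTower_integral (ν : Measure ℝ≥0∞) [IsProbabilityMeasure ν] :
    IsRankTower fun l r k s => ∫ ζ, ewensTower ζ l r k s ∂ν := by
  have hi := integrable_ewensTower ν
  refine ⟨fun l r => ⟨fun k s => ?_, fun k s => ?_⟩, fun l r k s => ?_, fun l r k s => ?_⟩
  · exact integral_nonneg fun ζ => ((isRankTower_ewensTower ζ).family l r).nonneg k s
  · rw [← integral_const_mul, ← integral_add (hi _ _ _ _) ((hi _ _ _ _).const_mul _)]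
    exact integral_congr_ae (Eventually.of_forall fun ζ =>
      ((isRankTower_ewensTower ζ).family l r).coherent k s)
  · rw [← integral_add (hi _ _ _ _) (hi _ _ _ _)]
    exact integral_congr_ae (Eventually.of_forall fun ζ => (isRankTower_ewensTower ζ).split l r k s)
  · rw [← integral_const_mul, ← integral_add (hi _ _ _ _) ((hi _ _ _ _).const_mul _)]
    exact integral_congr_ae (Eventually.of_forall fun ζ => (isRankTower_ewensTower ζ).res l r k s)

/-- Every normalized rank family is a mixture of the Ewens families. -/
lemma IsRankFamily.exists_mixture {g : ℕ → ℕ → ℝ} (hg : IsRankFamily g) (h1 : g 0 0 = 1) :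
    ∃ ν : Measure ℝ≥0∞, IsProbabilityMeasure ν ∧
      ∀ k s, g k s = ∫ ζ, ewensTower ζ 0 0 k s ∂ν := by
  obtain ⟨c, hc, rfl⟩ := hg.exists_tower
  obtain ⟨ν, hν, hmom⟩ := exists_measure_moments (b := fun l r => c l r 0 0)
    (fun l r => (hc.family l r).nonneg 0 0) h1 (fun l r => hc.split l r 0 0)
  refine ⟨ν, hν, fun k s => hc.eq_of_moments_eq (isRankTower_integral ν) (fun l => ?_) 0 k s⟩
  simp_rw [ewensTower_moment]
  exact (hmom l).symm

lemma measure_ext_of_ewensTower {ν ν' : Measure ℝ≥0∞} [IsProbabilityMeasure ν]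
    [IsProbabilityMeasure ν']
    (h : ∀ k s, ∫ ζ, ewensTower ζ 0 0 k s ∂ν = ∫ ζ, ewensTower ζ 0 0 k s ∂ν') : ν = ν' := by
  refine measure_ext_of_moments fun l => ?_
  have := congrFun₂ ((isRankTower_integral ν).eq_of_family_eq (isRankTower_integral ν')
    (funext₂ h) l) 0 0
  simpa only [ewensTower_moment] using this

/-- The number of upper records of an initial rank sequence, the first position not counted. -/
def upperRecords {n : ℕ} (i : (j : Fin n) → Fin (j.val + 1)) : ℕ :=
  (Finset.univ.filter fun j : Fin n => 1 ≤ j.val ∧ (i j).val = j.val).card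

lemma upperRecords_eq_sum {n : ℕ} (i : (j : Fin n) → Fin (j.val + 1)) :
    upperRecords i = ∑ j : Fin n, if 1 ≤ j.val ∧ (i j).val = j.val then 1 else 0 :=
  Finset.card_filter _ _

lemma upperRecords_succ {n : ℕ} (i : (j : Fin (n + 1)) → Fin (j.val + 1)) :
    upperRecords i = upperRecords (n := n) (fun j => i j.castSucc) +
      if 1 ≤ n ∧ (i (Fin.last n)).val = n then 1 else 0 := by
  rw [upperRecords_eq_sum, Fin.sum_univ_castSucc, upperRecords_eq_sum]
  rfl

lemma upperRecords_le {n : ℕ} (i : (j : Fin (n + 1)) → Fin (j.val + 1)) : upperRecords i ≤ n := by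
  induction n with
  | zero => simp [upperRecords]
  | succ n ih =>
    rw [upperRecords_succ]
    have := ih fun j => i j.castSucc
    split_ifs <;> omega

lemma prod_ewensUpWt {n : ℕ} (i : (j : Fin (n + 1)) → Fin (j.val + 1)) (ζ : ℝ≥0∞) :
    ∏ j, ewensUpWt ζ j.val (i j)
      = ENNReal.ofReal (ewensTower ζ 0 0 (upperRecords i) (n - upperRecords i)) := by
  induction n with
  | zero =>
    have := upperRecords_le i
    simp only [Nat.le_zero] at this
    simp [this, ewensTower_origin, ewensUpWt]
  | succ n ih =>
    rw [Fin.prod_univ_castSucc]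
    have ih' := ih fun j => i j.castSucc
    have hle := upperRecords_le fun j : Fin (n + 1) => i j.castSucc
    rw [upperRecords_succ]
    simp only [Fin.val_castSucc, Fin.val_last] at ih' ⊢
    rw [ih']
    generalize upperRecords (fun j : Fin (n + 1) => i j.castSucc) = k at *
    obtain ⟨s, rfl⟩ := Nat.exists_eq_add_of_le hle
    rw [Nat.add_sub_cancel_left]
    have hs : k + s + 1 - k = s + 1 := by omega
    by_cases hζ : ζ = ⊤
    · by_cases hv : (i (Fin.last (k + s + 1))).val = k + s + 1
      · simp [ewensUpWt, ewensTower, hζ, hv]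
      · simp [ewensUpWt, ewensTower, hζ, hv, hs]
    · have hz : 0 ≤ ζ.toReal := ENNReal.toReal_nonneg
      have hpos : 0 < ζ.toReal + (k + s + 1 : ℕ) := by positivity
      have hcast : ζ + ((k + s + 1 : ℕ) : ℝ≥0∞) = ENNReal.ofReal (ζ.toReal + (k + s + 1 : ℕ)) := by
        rw [ENNReal.ofReal_add hz (by positivity), ENNReal.ofReal_toReal hζ,
          ENNReal.ofReal_natCast]
      have hw : ewensUpWt ζ (k + s + 1) (i (Fin.last (k + s + 1)))
          = ENNReal.ofReal (if (i (Fin.last (k + s + 1))).val = k + s + 1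
            then ζ.toReal / (ζ.toReal + (k + s + 1 : ℕ))
            else 1 / (ζ.toReal + (k + s + 1 : ℕ))) := by
        rw [ewensUpWt, if_neg (by omega), if_neg hζ, hcast]
        split_ifs
        · rw [ENNReal.ofReal_div_of_pos hpos, ENNReal.ofReal_toReal hζ]
        · rw [ENNReal.ofReal_div_of_pos hpos, ENNReal.ofReal_one]
      rw [hw, ← ENNReal.ofReal_mul (((isRankTower_ewensTower ζ).family 0 0).nonneg k s)]
      congr 1
      by_cases hv : (i (Fin.last (k + s + 1))).val = k + s + 1
      · have hs' : k + s + 1 - (k + 1) = s := by omega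
        simp only [hv, hs', ewensTower, if_neg hζ, if_true, le_add_iff_nonneg_left, zero_le,
          true_and, and_true, add_zero, pow_zero, one_mul]
        rw [add_right_comm k 1 s, Finset.prod_range_succ, div_mul_div_comm, pow_succ]
      · simp only [hv, hs, ewensTower, if_neg hζ, if_false, and_false, add_zero, pow_zero, one_mul]
        rw [← add_assoc k s 1, Finset.prod_range_succ, div_mul_div_comm, mul_one]

lemma lintegral_prod_ewensUpWt (ν : Measure ℝ≥0∞) [IsProbabilityMeasure ν] {n : ℕ}
    (i : (j : Fin (n + 1)) → Fin (j.val + 1)) :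
    ∫⁻ ζ, ∏ j, ewensUpWt ζ j.val (i j) ∂ν = ENNReal.ofReal
      (∫ ζ, ewensTower ζ 0 0 (upperRecords i) (n - upperRecords i) ∂ν) := by
  simp_rw [prod_ewensUpWt]
  exact (ofReal_integral_eq_lintegral_ofReal (integrable_ewensTower ν _ _ _ _)
    (Eventually.of_forall fun ζ => ((isRankTower_ewensTower ζ).family 0 0).nonneg _ _)).symm

/-- The rank sequence of length `n + 1` whose upper records are at the indices up to `k`. -/
def recordsFirst (k n : ℕ) (j : Fin (n + 1)) : Fin (j.val + 1) :=
  if j.val ≤ k then Fin.last j.val else 0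

lemma upperRecords_recordsFirst (k n : ℕ) : upperRecords (recordsFirst k n) = min k n := by
  induction n with
  | zero => simp [upperRecords]
  | succ n ih =>
    rw [upperRecords_succ]
    have : upperRecords (fun j : Fin (n + 1) => recordsFirst k (n + 1) j.castSucc)
        = upperRecords (recordsFirst k n) := rfl
    rw [this, ih]
    have h2 : (recordsFirst k (n + 1) (Fin.last (n + 1))).val = if n + 1 ≤ k then n + 1 else 0 := by
      simp only [recordsFirst, Fin.val_last]
      split_ifs <;> simp
    rw [h2]
    by_cases h : n + 1 ≤ k
    · rw [if_pos h, if_pos (by simp)]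
      omega
    · rw [if_neg h, if_neg (by omega)]
      omega

lemma measurableSet_rankCyl {n : ℕ} (i : (j : Fin n) → Fin (j.val + 1)) :
    MeasurableSet (rankCyl i) := by
  rw [rankCyl, Set.ofPred_forall]
  exact MeasurableSet.iInter fun j => measurableSet_eq_fun (measurable_pi_apply _) measurable_const

/-- Appending one rank to an initial rank sequence. -/
def snocRank {n : ℕ} (i : (j : Fin n) → Fin (j.val + 1)) (v : Fin (n + 1)) (j : Fin (n + 1)) :
    Fin (j.val + 1) :=
  Fin.snoc (α := fun j : Fin (n + 1) => Fin (j.val + 1)) i v j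

lemma upperRecords_snocRank {n : ℕ} (i : (j : Fin n) → Fin (j.val + 1)) (v : Fin (n + 1)) :
    upperRecords (snocRank i v) = upperRecords i + if 1 ≤ n ∧ v.val = n then 1 else 0 := by
  rw [upperRecords_succ]
  simp [snocRank]

lemma measure_rankCyl_eq_sum (P : Measure RankSpace) {n : ℕ}
    (i : (j : Fin n) → Fin (j.val + 1)) :
    P (rankCyl i) = ∑ v, P (rankCyl (snocRank i v)) := by
  have hU : rankCyl i = ⋃ v, rankCyl (snocRank i v) := by
    ext ω
    simp only [rankCyl, Set.mem_ofPred_eq, Set.mem_iUnion, Fin.forall_fin_succ', snocRank,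
      Fin.snoc_castSucc, Fin.snoc_last]
    exact ⟨fun h => ⟨ω n, h, rfl⟩, fun ⟨_, h, _⟩ => h⟩
  rw [hU, measure_iUnion _ fun v => measurableSet_rankCyl _, tsum_fintype]
  intro v w hvw
  refine Set.disjoint_left.2 fun ω hv hw => hvw ?_
  have h1 := hv (Fin.last n)
  have h2 := hw (Fin.last n)
  simp only [snocRank, Fin.snoc_last] at h1 h2
  exact h1.symm.trans h2

/-- The common probability of the cylinders of length `k + s + 1` with `k` upper records. -/
noncomputable def cylProb (P : Measure RankSpace) (k s : ℕ) : ℝ :=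
  P.real (rankCyl (recordsFirst k (k + s)))

lemma measureReal_rankCyl {P : Measure RankSpace}
    (hP : ∀ (n : ℕ) (i i' : (j : Fin n) → Fin (j.val + 1)),
      upperRecords i = upperRecords i' → P (rankCyl i) = P (rankCyl i'))
    {k s : ℕ} (i : (j : Fin (k + s + 1)) → Fin (j.val + 1))
    (hi : upperRecords i = k) : P.real (rankCyl i) = cylProb P k s := by
  rw [cylProb, Measure.real, Measure.real, hP _ i (recordsFirst k (k + s))]
  rw [hi, upperRecords_recordsFirst, min_eq_left (Nat.le_add_right k s)]

lemma isRankFamily_cylProb {P : Measure RankSpace} [IsProbabilityMeasure P]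
    (hP : ∀ (n : ℕ) (i i' : (j : Fin n) → Fin (j.val + 1)),
      upperRecords i = upperRecords i' → P (rankCyl i) = P (rankCyl i')) :
    IsRankFamily (cylProb P) where
  nonneg k s := measureReal_nonneg
  coherent k s := by
    have hk : upperRecords (recordsFirst k (k + s)) = k := by
      rw [upperRecords_recordsFirst, min_eq_left (Nat.le_add_right k s)]
    conv_lhs => rw [cylProb, Measure.real, measure_rankCyl_eq_sum,
      ENNReal.toReal_sum fun v _ => measure_ne_top _ _]
    rw [Fin.sum_univ_castSucc, add_comm]
    congr 1
    · have h := upperRecords_snocRank (recordsFirst k (k + s)) (Fin.last (k + s + 1))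
      rw [hk] at h
      simp only [Fin.val_last, le_add_iff_nonneg_left, zero_le, and_self, if_true] at h
      have e : k + s + 1 = k + 1 + s := by omega
      rw [cylProb, Measure.real]
      congr 1
      generalize snocRank (recordsFirst k (k + s)) (Fin.last (k + s + 1)) = i at *
      clear hk
      revert i
      rw [e]
      intro i hi
      refine hP _ _ _ ?_
      rw [hi, upperRecords_recordsFirst, min_eq_left (Nat.le_add_right _ s)]
    · rw [Finset.sum_congr rfl (g := fun _ => cylProb P k (s + 1))]
      · simp
      · intro v _
        refine measureReal_rankCyl hP (k := k) (s := s + 1) _ ?_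
        have h := upperRecords_snocRank (recordsFirst k (k + s)) v.castSucc
        rw [hk, if_neg (by simp only [Fin.val_castSucc]; omega)] at h
        exact h

/-- if each cylinder probability depends only on the number of upper
records `#{2 ≤ j ≤ n : i_j = j}`, then `P` is a unique mixture of the Ewens laws `Q^ζ`,
`ζ ∈ [0,∞]`. -/
theorem stmt_13 (P : Measure RankSpace) [IsProbabilityMeasure P]
    (hP : ∀ (n : ℕ) (i i' : (j : Fin n) → Fin (j.val + 1)),
      (Finset.univ.filter fun j : Fin n => 1 ≤ j.val ∧ (i j).val = j.val).card
        = (Finset.univ.filter fun j : Fin n => 1 ≤ j.val ∧ (i' j).val = j.val).card →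
      P (rankCyl i) = P (rankCyl i')) :
    ∃! ν : Measure ℝ≥0∞, IsProbabilityMeasure ν ∧
      ∀ (n : ℕ) (i : (j : Fin n) → Fin (j.val + 1)),
        P (rankCyl i) = ∫⁻ ζ, ∏ j : Fin n, ewensUpWt ζ j.val (i j) ∂ν := by
  have h0 : cylProb P 0 0 = 1 := by
    have : rankCyl (recordsFirst 0 0) = Set.univ := by
      ext ω
      simpa [rankCyl, recordsFirst] using Fin.fin_one_eq_zero (ω 0)
    rw [cylProb, this, probReal_univ]
  obtain ⟨ν, hν, hg⟩ := (isRankFamily_cylProb hP).exists_mixture h0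
  refine ⟨ν, ⟨hν, fun n i => ?_⟩, ?_⟩
  · cases n with
    | zero =>
      have : rankCyl i = Set.univ := by
        ext ω
        simp [rankCyl]
      simp [this]
    | succ n =>
      rw [lintegral_prod_ewensUpWt, ← hg, ← ofReal_measureReal]
      have hle := upperRecords_le i
      generalize hk : upperRecords i = k at *
      obtain ⟨s, rfl⟩ := Nat.exists_eq_add_of_le hle
      rw [Nat.add_sub_cancel_left, measureReal_rankCyl hP i hk]
  · rintro ν' ⟨hν', h⟩
    refine measure_ext_of_ewensTower fun k s => ?_
    have h1 := h _ (recordsFirst k (k + s))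
    rw [lintegral_prod_ewensUpWt, ← ofReal_measureReal, upperRecords_recordsFirst,
      min_eq_left (Nat.le_add_right k s), Nat.add_sub_cancel_left,
      ENNReal.ofReal_eq_ofReal_iff measureReal_nonneg
        (integral_nonneg fun ζ => ((isRankTower_ewensTower ζ).family 0 0).nonneg k s)] at h1
    rw [← h1, ← hg, cylProb]
end
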